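/- arXiv:1211.2463 — 3 statements merged into one kernel-verified Lean document; each statement's English description precedes it below -/
import Mathlib

section
/- Let 3 < α < 5, let w be a Lane-Emden enthalpy profile, and let φ₀ be a growing-mode profile with eigenvalue μ₀ > 0. Then for every real β with 0 ≤ β ≤ α, the integrals ∫₀^R w^{α−β} r⁴ φ₀(r)² dr and ∫₀^R w^{1+α−β} r⁴ φ₀'(r)² dr are finite. Moreover, for every real z > 1, ∫₀^R w^{z−2} r⁴ φ₀(r)² dr < ∞. -/
open MeasureTheory Real Filter Set

/-- Finiteness of the norm `‖φ‖² = ∫ w^{1+α} r⁴ φ'² − ∫ (w^{1+α})' r³ φ² + ∫ w^α r⁴ φ²`. -/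
def FiniteNorm (α R : ℝ) (w φ : ℝ → ℝ) : Prop :=
  MeasureTheory.IntegrableOn (fun r => w r ^ (1 + α) * r ^ 4 * (deriv φ r) ^ 2)
      (Set.Ioo 0 R) ∧
  MeasureTheory.IntegrableOn (fun r => deriv (fun s => w s ^ (1 + α)) r * r ^ 3 * (φ r) ^ 2)
      (Set.Ioo 0 R) ∧
  MeasureTheory.IntegrableOn (fun r => w r ^ α * r ^ 4 * (φ r) ^ 2) (Set.Ioo 0 R)

theorem hasDerivAt_sub_rpow {R e x : ℝ} (hx : x < R) :
    HasDerivAt (fun y => (R - y) ^ e) (-(e * (R - x) ^ (e - 1))) x := by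
  have h := ((hasDerivAt_id x).const_sub R).rpow_const (p := e) (Or.inl (sub_pos.2 hx).ne')
  exact h.congr_deriv (by simp)

/-- A power bound on the derivative controls increments. -/
theorem abs_sub_le_of_abs_deriv_le_rpow {f f' : ℝ → ℝ} {a R C e : ℝ} (he : e + 1 ≠ 0)
    (hf : ∀ r ∈ Ico a R, HasDerivAt f (f' r) r)
    (hb : ∀ r ∈ Ico a R, |f' r| ≤ C * (R - r) ^ e) {s t : ℝ} (has : a ≤ s) (hst : s ≤ t)
    (htR : t < R) :
    |f t - f s| ≤ C / (e + 1) * ((R - s) ^ (e + 1) - (R - t) ^ (e + 1)) := by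
  have hmem : ∀ x ∈ Icc s t, x ∈ Ico a R := fun x hx => ⟨has.trans hx.1, hx.2.trans_lt htR⟩
  have hF : ∀ x ∈ Icc s t, HasDerivAt (fun y => f y - f s) (f' x) x :=
    fun x hx => (hf x (hmem x hx)).sub_const _
  have hB : ∀ x ∈ Icc s t, HasDerivAt
      (fun y => C / (e + 1) * ((R - s) ^ (e + 1) - (R - y) ^ (e + 1))) (C * (R - x) ^ e) x := by
    intro x hx
    have h := ((hasDerivAt_sub_rpow (e := e + 1) (hmem x hx).2).const_sub
      ((R - s) ^ (e + 1))).const_mul (C / (e + 1))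
    refine h.congr_deriv ?_
    rw [add_sub_cancel_right]
    field_simp
  exact image_norm_le_of_norm_deriv_right_le_deriv_boundary'
    (f := fun y => f y - f s)
    (fun x hx => (hF x hx).continuousAt.continuousWithinAt)
    (fun x hx => (hF x (Ico_subset_Icc_self hx)).hasDerivWithinAt) (by simp)
    (fun x hx => (hB x hx).continuousAt.continuousWithinAt)
    (fun x hx => (hB x (Ico_subset_Icc_self hx)).hasDerivWithinAt)
    (fun x hx => hb x (hmem x (Ico_subset_Icc_self hx))) (right_mem_Icc.2 hst)

theorem abs_le_of_tendsto_zero_of_abs_deriv_le_rpow {f f' : ℝ → ℝ} {a R C e : ℝ} (he : -1 < e)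
    (hC : 0 ≤ C) (hf : ∀ r ∈ Ico a R, HasDerivAt f (f' r) r)
    (hb : ∀ r ∈ Ico a R, |f' r| ≤ C * (R - r) ^ e) (h0 : Tendsto f (nhdsWithin R (Iio R)) (nhds 0))
    {s : ℝ} (hs : s ∈ Ico a R) : |f s| ≤ C / (e + 1) * (R - s) ^ (e + 1) := by
  have hlim : Tendsto (fun t => |f t - f s|) (nhdsWithin R (Iio R)) (nhds |0 - f s|) :=
    (h0.sub_const _).abs
  have hev : ∀ᶠ t in nhdsWithin R (Iio R), |f t - f s| ≤ C / (e + 1) * (R - s) ^ (e + 1) := by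
    filter_upwards [Ioo_mem_nhdsLT hs.2] with t ht
    refine (abs_sub_le_of_abs_deriv_le_rpow (by linarith) hf hb hs.1 ht.1.le ht.2).trans ?_
    gcongr
    · exact div_nonneg hC (by linarith)
    · linarith [rpow_nonneg (sub_pos.2 ht.2).le (e + 1)]
  simpa using le_of_tendsto hlim hev

theorem exists_abs_le_rpow_of_abs_deriv_le_rpow {f f' : ℝ → ℝ} {a R C e : ℝ} (he : e < -1)
    (haR : a < R) (hC : 0 ≤ C) (hf : ∀ r ∈ Ico a R, HasDerivAt f (f' r) r)
    (hb : ∀ r ∈ Ico a R, |f' r| ≤ C * (R - r) ^ e) :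
    ∃ C', 0 ≤ C' ∧ ∀ r ∈ Ico a R, |f r| ≤ C' * (R - r) ^ (e + 1) := by
  have hC' : 0 ≤ C / -(e + 1) := div_nonneg hC (by linarith)
  have haR' : 0 < (R - a) ^ (e + 1) := rpow_pos_of_pos (sub_pos.2 haR) _
  refine ⟨|f a| / (R - a) ^ (e + 1) + C / -(e + 1), by positivity, fun r hr => ?_⟩
  have h1 := abs_sub_le_of_abs_deriv_le_rpow (by linarith) hf hb le_rfl hr.1 hr.2
  have h2 : (R - a) ^ (e + 1) ≤ (R - r) ^ (e + 1) :=
    rpow_le_rpow_of_nonpos (sub_pos.2 hr.2) (by linarith [hr.1]) (by linarith)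
  have h3 : |f r| ≤ |f a| + |f r - f a| := by
    simpa using abs_add_le (f a) (f r - f a)
  have h4 : |f a| ≤ |f a| / (R - a) ^ (e + 1) * (R - r) ^ (e + 1) := by
    rw [div_mul_eq_mul_div, le_div_iff₀ haR']
    gcongr
  have h5 : C / (e + 1) * ((R - a) ^ (e + 1) - (R - r) ^ (e + 1))
      = C / -(e + 1) * ((R - r) ^ (e + 1) - (R - a) ^ (e + 1)) := by
    rw [div_neg]; ring
  nlinarith [mul_nonneg hC' haR'.le]

theorem exists_abs_le_of_abs_deriv_le_rpow {f f' : ℝ → ℝ} {a R C e : ℝ} (he : -1 < e)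
    (hC : 0 ≤ C) (hf : ∀ r ∈ Ico a R, HasDerivAt f (f' r) r)
    (hb : ∀ r ∈ Ico a R, |f' r| ≤ C * (R - r) ^ e) :
    ∃ C', 0 ≤ C' ∧ ∀ r ∈ Ico a R, |f r| ≤ C' := by
  have hC' : 0 ≤ C / (e + 1) := div_nonneg hC (by linarith)
  rcases le_or_gt R a with haR | haR
  · exact ⟨0, le_rfl, fun r hr => absurd (hr.1.trans_lt hr.2) haR.not_gt⟩
  refine ⟨|f a| + C / (e + 1) * (R - a) ^ (e + 1),
    add_nonneg (abs_nonneg _) (mul_nonneg hC' (rpow_nonneg (sub_pos.2 haR).le _)), fun r hr => ?_⟩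
  have h1 := abs_sub_le_of_abs_deriv_le_rpow (by linarith) hf hb le_rfl hr.1 hr.2
  have h3 : |f r| ≤ |f a| + |f r - f a| := by
    simpa using abs_add_le (f a) (f r - f a)
  have h4 := mul_nonneg hC' (rpow_nonneg (sub_pos.2 hr.2).le (e + 1))
  linarith [mul_sub (C / (e + 1)) ((R - a) ^ (e + 1)) ((R - r) ^ (e + 1))]

theorem not_integrableOn_sub_rpow {s R e : ℝ} (hsR : s < R) (he : e ≤ -1) :
    ¬ IntegrableOn (fun r => (R - r) ^ e) (Ioo s R) := by
  intro h
  have h1 : IntervalIntegrable (fun r => (R - r) ^ e) volume s R :=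
    (intervalIntegrable_iff_integrableOn_Ioo_of_le hsR.le).2 h
  have h2 := (h1.comp_sub_left R).symm
  simp only [sub_sub_cancel, sub_self] at h2
  rw [intervalIntegrable_iff_integrableOn_Ioo_of_le (sub_pos.2 hsR).le,
    intervalIntegral.integrableOn_Ioo_rpow_iff (sub_pos.2 hsR)] at h2
  linarith

theorem integrableOn_sub_rpow {s R e : ℝ} (hsR : s < R) (he : -1 < e) :
    IntegrableOn (fun r => (R - r) ^ e) (Ioo s R) := by
  have h := (intervalIntegral.intervalIntegrable_rpow' (a := 0) (b := R - s) he).comp_sub_left R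
  simp only [sub_sub_cancel, sub_zero] at h
  exact (intervalIntegrable_iff_integrableOn_Ioo_of_le hsR.le).1 h.symm

/-- Cauchy–Schwarz estimate for the increments of the flux. -/
theorem abs_sub_le_of_abs_deriv_le_rpow_mul {F f : ℝ → ℝ} {α a R G : ℝ} (hα : 0 ≤ α) (hG : 0 ≤ G)
    (hF : ∀ r ∈ Ico a R, DifferentiableAt ℝ F r)
    (hb : ∀ r ∈ Ico a R, |deriv F r| ≤ G * ((R - r) ^ α * |f r|))
    (hf : IntegrableOn (fun r => (R - r) ^ α * f r ^ 2) (Ioo a R))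
    {s t : ℝ} (has : a ≤ s) (hst : s ≤ t) (htR : t < R) :
    |F t - F s| ≤ G / 2 * (1 + ∫ r in Ioo a R, (R - r) ^ α * f r ^ 2)
      * (R - s) ^ ((α + 1) / 2) := by
  have hmem : ∀ x ∈ Icc s t, x ∈ Ico a R := fun x hx => ⟨has.trans hx.1, hx.2.trans_lt htR⟩
  have hsR : 0 < R - s := by linarith
  set I := ∫ r in Ioo a R, (R - r) ^ α * f r ^ 2 with hI
  set τ := (R - s) ^ ((α + 1) / 2) with hτ
  have hτ0 : 0 < τ := rpow_pos_of_pos hsR _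
  have hττ : (R - s) ^ α * (R - s) = τ * τ := by
    rw [hτ, ← rpow_add hsR, ← rpow_add_one hsR.ne']
    ring_nf
  have hsub : Ioo s t ⊆ Ioo a R := Ioo_subset_Ioo has htR.le
  have hfi : IntervalIntegrable (fun r => (R - r) ^ α * f r ^ 2) volume s t :=
    (intervalIntegrable_iff_integrableOn_Ioo_of_le hst).2 (hf.mono_set hsub)
  have key := norm_sub_le_integral_of_norm_deriv_le_of_le (f := F)
    (B := fun r => G / 2 * (τ⁻¹ * (R - s) ^ α) + G / 2 * τ * ((R - r) ^ α * f r ^ 2)) hst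
    (fun x hx => (hF x (hmem x hx)).continuousAt.continuousWithinAt)
    (fun x hx => (hF x (hmem x (Ioo_subset_Icc_self hx))).differentiableWithinAt)
    (Eventually.of_forall fun x hx => by
      have hx' := hmem x (Ioo_subset_Icc_self hx)
      refine (hb x hx').trans ?_
      have h1 : (R - x) ^ α ≤ (R - s) ^ α :=
        rpow_le_rpow (by linarith [hx'.2]) (by linarith [hx.1]) hα
      have h0 : 0 ≤ (R - x) ^ α := rpow_nonneg (by linarith [hx'.2]) _
      have h2 : 2 * |f x| ≤ τ⁻¹ + τ * f x ^ 2 := by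
        rw [← sq_abs (f x)]
        have h3 : τ⁻¹ + τ * |f x| ^ 2 - 2 * |f x| = τ⁻¹ * (1 - τ * |f x|) ^ 2 := by
          field_simp
          ring
        have : 0 ≤ τ⁻¹ * (1 - τ * |f x|) ^ 2 := by positivity
        linarith
      calc G * ((R - x) ^ α * |f x|) = G / 2 * ((R - x) ^ α * (2 * |f x|)) := by ring
        _ ≤ G / 2 * ((R - x) ^ α * (τ⁻¹ + τ * f x ^ 2)) := by gcongr
        _ = G / 2 * (τ⁻¹ * (R - x) ^ α) + G / 2 * τ * ((R - x) ^ α * f x ^ 2) := by ring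
        _ ≤ _ := by gcongr)
    (intervalIntegrable_const.add (hfi.const_mul _))
  rw [intervalIntegral.integral_add intervalIntegrable_const (hfi.const_mul _),
    intervalIntegral.integral_const, intervalIntegral.integral_const_mul, smul_eq_mul,
    intervalIntegral.integral_of_le hst, ← Measure.restrict_congr_set Ioo_ae_eq_Ioc] at key
  have hle : ∫ r in Ioo s t, (R - r) ^ α * f r ^ 2 ≤ I :=
    setIntegral_mono_set hf (ae_restrict_of_forall_mem measurableSet_Ioo fun x hx =>
      mul_nonneg (rpow_nonneg (by linarith [hx.2]) _) (sq_nonneg _)) hsub.eventuallyLE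
  refine key.trans ?_
  have hp : 0 ≤ (R - s) ^ α := rpow_nonneg hsR.le _
  have h6 : (t - s) * (G / 2 * (τ⁻¹ * (R - s) ^ α)) ≤ G / 2 * τ := by
    calc (t - s) * (G / 2 * (τ⁻¹ * (R - s) ^ α))
        ≤ (R - s) * (G / 2 * (τ⁻¹ * (R - s) ^ α)) := by gcongr
      _ = G / 2 * (τ⁻¹ * ((R - s) ^ α * (R - s))) := by ring
      _ = G / 2 * τ := by rw [hττ]; field_simp
  have h7 : G / 2 * τ * ∫ r in Ioo s t, (R - r) ^ α * f r ^ 2 ≤ G / 2 * τ * I := by gcongr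
  linarith

/-- Boundedness at the vacuum boundary of a finite-energy solution of a singular first-order
system `F' = O((R - r) ^ α f)`, `F ≍ (R - r) ^ (1 + α) f'`. -/
theorem exists_bound_of_singular_system {F f f' : ℝ → ℝ} {α a R G K L : ℝ} (hα : 3 < α)
    (hα' : α < 5) (haR : a < R) (hG : 0 ≤ G) (hK : 0 ≤ K)
    (hF : ∀ r ∈ Ico a R, DifferentiableAt ℝ F r)
    (hf : ∀ r ∈ Ico a R, HasDerivAt f (f' r) r)
    (hFb : ∀ r ∈ Ico a R, |deriv F r| ≤ G * ((R - r) ^ α * |f r|))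
    (hKb : ∀ r ∈ Ico a R, |f' r| ≤ K * ((R - r) ^ (-(1 + α)) * |F r|))
    (hLb : ∀ r ∈ Ico a R, |F r| ≤ L * ((R - r) ^ (1 + α) * |f' r|))
    (hfi : IntegrableOn (fun r => (R - r) ^ α * f r ^ 2) (Ioo a R))
    (hfi' : IntegrableOn (fun r => (R - r) ^ (1 + α) * f' r ^ 2) (Ioo a R)) :
    ∃ C, ∀ r ∈ Ico a R, |f r| ≤ C ∧ |f' r| ≤ C := by
  have hFd : ∀ r ∈ Ico a R, HasDerivAt F (deriv F r) r := fun r hr => (hF r hr).hasDerivAt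
  set D := G / 2 * (1 + ∫ r in Ioo a R, (R - r) ^ α * f r ^ 2) with hD
  have hD0 : 0 ≤ D := by
    have : 0 ≤ ∫ r in Ioo a R, (R - r) ^ α * f r ^ 2 :=
      setIntegral_nonneg measurableSet_Ioo fun x hx =>
        mul_nonneg (rpow_nonneg (by linarith [hx.2]) _) (sq_nonneg _)
    positivity
  have hF0 : ∀ s ∈ Ico a R, |F s| ≤ D * (R - s) ^ ((α + 1) / 2) := by
    intro s hs
    by_contra! hcon
    set δ := |F s| - D * (R - s) ^ ((α + 1) / 2) with hδ
    have hδ0 : 0 < δ := by linarith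
    refine not_integrableOn_sub_rpow (e := -(1 + α)) hs.2 (by linarith) ?_
    have hdom := (hfi'.mono_set (Ioo_subset_Ioo_left hs.1)).const_mul (L ^ 2 / δ ^ 2)
    refine Integrable.mono' hdom
      ((measurable_const.sub measurable_id).pow_const _).aestronglyMeasurable
      (ae_restrict_of_forall_mem measurableSet_Ioo ?_)
    intro t ht
    have htm : t ∈ Ico a R := ⟨hs.1.trans ht.1.le, ht.2⟩
    have htR : 0 < R - t := sub_pos.2 ht.2
    have h1 := abs_sub_le_of_abs_deriv_le_rpow_mul (by linarith) hG hF hFb hfi hs.1 ht.1.le ht.2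
    rw [← hD] at h1
    have h2 : δ ≤ |F t| := by
      have := abs_sub_abs_le_abs_sub (F s) (F t)
      rw [abs_sub_comm] at this
      linarith
    have hx : 0 < (R - t) ^ (1 + α) := rpow_pos_of_pos htR _
    have h3 : δ ^ 2 ≤ L ^ 2 * ((R - t) ^ (1 + α)) ^ 2 * f' t ^ 2 := by
      have h4 := h2.trans (hLb t htm)
      have := pow_le_pow_left₀ hδ0.le h4 2
      rw [mul_pow, mul_pow, sq_abs] at this
      linarith
    rw [Real.norm_eq_abs, abs_of_pos (rpow_pos_of_pos htR _), rpow_neg htR.le, inv_eq_one_div,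
      div_le_iff₀ hx, div_mul_eq_mul_div, div_mul_eq_mul_div, le_div_iff₀ (by positivity)]
    linarith
  have hlim : Tendsto F (nhdsWithin R (Iio R)) (nhds 0) := by
    refine squeeze_zero_norm' (a := fun s => D * (R - s) ^ ((α + 1) / 2)) ?_ ?_
    · filter_upwards [Ico_mem_nhdsLT haR] with s hs using hF0 s hs
    · have hc : Continuous fun s => D * (R - s) ^ ((α + 1) / 2) :=
        continuous_const.mul ((continuous_const.sub continuous_id).rpow_const
          fun _ => Or.inr (by linarith))
      have := hc.tendsto R
      rw [sub_self, zero_rpow (by linarith), mul_zero] at this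
      exact this.mono_left nhdsWithin_le_nhds
  have flux : ∀ C e, 0 ≤ C → (∀ r ∈ Ico a R, |F r| ≤ C * (R - r) ^ (e + (1 + α))) →
      ∀ r ∈ Ico a R, |f' r| ≤ K * C * (R - r) ^ e := by
    intro C e hC h r hr
    have hr0 : 0 < R - r := sub_pos.2 hr.2
    calc |f' r| ≤ K * ((R - r) ^ (-(1 + α)) * |F r|) := hKb r hr
      _ ≤ K * ((R - r) ^ (-(1 + α)) * (C * (R - r) ^ (e + (1 + α)))) := by
        gcongr
        exact h r hr
      _ = K * C * (R - r) ^ e := by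
        have : (R - r) ^ e = (R - r) ^ (-(1 + α)) * (R - r) ^ (e + (1 + α)) := by
          rw [← rpow_add hr0]
          ring_nf
        rw [this]
        ring
  have improve : ∀ C e, 0 ≤ C → -1 < α + e → (∀ r ∈ Ico a R, |f r| ≤ C * (R - r) ^ e) →
      ∃ C', 0 ≤ C' ∧ ∀ r ∈ Ico a R, |f' r| ≤ C' * (R - r) ^ e := by
    intro C e hC he h
    have hpos : 0 ≤ G * C / (α + e + 1) := div_nonneg (by positivity) (by linarith)
    refine ⟨K * (G * C / (α + e + 1)), by positivity, flux _ e hpos fun r hr => ?_⟩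
    have := abs_le_of_tendsto_zero_of_abs_deriv_le_rpow he (mul_nonneg hG hC) hFd
      (fun r hr => by
        have hr0 : 0 < R - r := sub_pos.2 hr.2
        calc |deriv F r| ≤ G * ((R - r) ^ α * |f r|) := hFb r hr
          _ ≤ G * ((R - r) ^ α * (C * (R - r) ^ e)) := by
            gcongr
            exact h r hr
          _ = G * C * (R - r) ^ (α + e) := by
            rw [rpow_add hr0]
            ring) hlim hr
    rwa [show e + (1 + α) = α + e + 1 by ring]
  have hf0 := flux D (-((α + 1) / 2)) hD0 fun r hr => by
    convert hF0 r hr using 3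
    ring
  obtain ⟨C₁, hC₁, h₁⟩ := exists_abs_le_rpow_of_abs_deriv_le_rpow (by linarith) haR
    (mul_nonneg hK hD0) hf hf0
  obtain ⟨C₂, hC₂, h₂⟩ := improve C₁ _ hC₁ (by linarith) h₁
  obtain ⟨C₃, hC₃, h₃⟩ := exists_abs_le_rpow_of_abs_deriv_le_rpow (by linarith) haR hC₂ hf h₂
  obtain ⟨C₄, hC₄, h₄⟩ := improve C₃ _ hC₃ (by linarith) h₃
  obtain ⟨C₅, hC₅, h₅⟩ := exists_abs_le_of_abs_deriv_le_rpow (by linarith) hC₄ hf h₄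
  obtain ⟨C₆, hC₆, h₆⟩ := improve C₅ 0 hC₅ (by linarith) (by simpa using h₅)
  exact ⟨max C₅ C₆, fun r hr => ⟨(h₅ r hr).trans (le_max_left _ _),
    (by simpa using h₆ r hr : |f' r| ≤ C₆).trans (le_max_right _ _)⟩⟩

theorem exists_linear_bounds_near_vacuum {w : ℝ → ℝ} {R w'R : ℝ} (hR : 0 < R)
    (hw_cont : ContinuousOn w (Icc 0 R)) (hw_diff : ∀ r ∈ Ioo 0 R, DifferentiableAt ℝ w r)
    (hwR : w R = 0) (hneg : w'R < 0) (hlim : Tendsto (deriv w) (nhdsWithin R (Iio R)) (nhds w'R)) :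
    ∃ a m M, 0 < a ∧ a < R ∧ 0 < m ∧ 0 < M ∧
      (∀ r ∈ Ico a R, m * (R - r) ≤ w r ∧ w r ≤ M * (R - r)) ∧
      ∀ r ∈ Ico a R, |deriv w r| ≤ M := by
  have hev : ∀ᶠ r in nhdsWithin R (Iio R), deriv w r ∈ Ioo (2 * w'R) (w'R / 2) :=
    hlim (Ioo_mem_nhds (by linarith) (by linarith))
  obtain ⟨b, hb, hbs⟩ := mem_nhdsLT_iff_exists_Ico_subset.1
    (hev.and (Ioo_mem_nhdsLT hR))
  have hd : ∀ r ∈ Ico b R, deriv w r ∈ Ioo (2 * w'R) (w'R / 2) := fun r hr => (hbs hr).1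
  have hb0 : 0 < b := (hbs ⟨le_rfl, hb⟩).2.1
  refine ⟨b, -w'R / 2, -(2 * w'R), hb0, hb, by linarith, by linarith, fun r hr => ?_,
    fun r hr => ?_⟩
  · have hr0 : 0 < r := hb0.trans_le hr.1
    obtain ⟨ξ, hξ, hξ'⟩ := exists_deriv_eq_slope w hr.2
      (hw_cont.mono (Icc_subset_Icc_left hr0.le))
      (fun x hx => (hw_diff x ⟨hr0.trans hx.1, hx.2⟩).differentiableWithinAt)
    have hRr : 0 < R - r := sub_pos.2 hr.2
    have h := hd ξ ⟨hr.1.trans hξ.1.le, hξ.2⟩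
    rw [hξ', hwR, zero_sub] at h
    have h1 := (lt_div_iff₀ hRr).1 h.1
    have h2 := (div_lt_iff₀ hRr).1 h.2
    constructor <;> linarith
  · have h := hd r hr
    rw [abs_of_neg (by linarith [h.2])]
    linarith [h.1]

theorem rpow_le_of_linear_bounds {x y m M : ℝ} (hx : 0 < x) (hm : 0 < m) (hM : 0 < M)
    (h1 : m * x ≤ y) (h2 : y ≤ M * x) (e : ℝ) : y ^ e ≤ (m ^ e + M ^ e) * x ^ e := by
  have hmx : 0 < m * x := mul_pos hm hx
  rcases le_total 0 e with he | he
  · have h := rpow_le_rpow (hmx.le.trans h1) h2 he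
    rw [mul_rpow hM.le hx.le] at h
    have : 0 ≤ m ^ e * x ^ e := by positivity
    linarith
  · have h := rpow_le_rpow_of_nonpos hmx h1 he
    rw [mul_rpow hm.le hx.le] at h
    have : 0 ≤ M ^ e * x ^ e := by positivity
    linarith

/-- Finiteness of a weighted integral whose weight degenerates linearly at `R` passes to any
locally integrable weight, provided the integrand is bounded near `R`. -/
theorem integrableOn_weight_of_bounded {w g : ℝ → ℝ} {a m M R C e e₀ : ℝ} (ha : 0 < a)
    (haR : a < R) (hm : 0 < m) (hM : 0 < M)
    (hw_cont : ContinuousOn w (Icc 0 R)) (hw_pos : ∀ r, 0 ≤ r → r < R → 0 < w r)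
    (hw : ∀ r ∈ Ico a R, m * (R - r) ≤ w r ∧ w r ≤ M * (R - r))
    (hg : ContinuousOn g (Ioo 0 R)) (hgb : ∀ r ∈ Ico a R, |g r| ≤ C)
    (hgi : IntegrableOn (fun r => w r ^ e₀ * r ^ 4 * g r ^ 2) (Ioo 0 R)) (he : -1 < e) :
    IntegrableOn (fun r => w r ^ e * r ^ 4 * g r ^ 2) (Ioo 0 R) := by
  rw [← Ioc_union_Ioo_eq_Ioo ha.le haR]
  refine IntegrableOn.union ?_ ?_
  · have hc : ContinuousOn (fun r => w r ^ (e - e₀)) (Icc 0 a) :=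
      (hw_cont.mono (Icc_subset_Icc_right haR.le)).rpow_const
        fun r hr => Or.inl (hw_pos r hr.1 (hr.2.trans_lt haR)).ne'
    refine (IntegrableOn.continuousOn_mul_of_subset hc
      (hgi.mono_set (Ioc_subset_Ioo_right haR)) isCompact_Icc measurableSet_Ioc
      Ioc_subset_Icc_self).congr_fun ?_ measurableSet_Ioc
    intro r hr
    have hwr := hw_pos r hr.1.le (hr.2.trans_lt haR)
    simp only [← mul_assoc]
    rw [← rpow_add hwr, sub_add_cancel]
  · have hsub : Ioo a R ⊆ Ioo 0 R := Ioo_subset_Ioo_left ha.le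
    refine Integrable.mono' ((integrableOn_sub_rpow haR he).const_mul
      ((m ^ e + M ^ e) * R ^ 4 * C ^ 2)) ?_ (ae_restrict_of_forall_mem measurableSet_Ioo ?_)
    · refine ContinuousOn.aestronglyMeasurable ?_ measurableSet_Ioo
      have hwc : ContinuousOn (fun r => w r ^ e) (Ioo a R) :=
        (hw_cont.mono fun r hr => ⟨(ha.trans hr.1).le, hr.2.le⟩).rpow_const
          fun r hr => Or.inl (hw_pos r (ha.trans hr.1).le hr.2).ne'
      exact (hwc.mul (continuousOn_id.pow 4)).mul ((hg.mono hsub).pow 2)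
    · intro r hr
      have hr' := Ioo_subset_Ico_self hr
      have hr0 : 0 < r := ha.trans hr.1
      have hwr : 0 < w r ^ e := rpow_pos_of_pos (hw_pos r hr0.le hr.2) _
      have h1 := rpow_le_of_linear_bounds (sub_pos.2 hr.2) hm hM (hw r hr').1 (hw r hr').2 e
      have h2 : g r ^ 2 ≤ C ^ 2 := sq_le_sq' (abs_le.1 (hgb r hr')).1 (abs_le.1 (hgb r hr')).2
      rw [Real.norm_eq_abs, abs_of_nonneg (by positivity)]
      calc w r ^ e * r ^ 4 * g r ^ 2
          ≤ ((m ^ e + M ^ e) * (R - r) ^ e) * R ^ 4 * C ^ 2 := by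
            have := hr.2.le
            have := hwr.le.trans h1
            gcongr
        _ = (m ^ e + M ^ e) * R ^ 4 * C ^ 2 * (R - r) ^ e := by ring

theorem integrableOn_sub_rpow_mul_sq_of_weight {w g : ℝ → ℝ} {a m R e : ℝ} (ha : 0 < a)
    (hm : 0 < m) (he : 0 ≤ e)
    (hw : ∀ r ∈ Ico a R, m * (R - r) ≤ w r) (hg : ContinuousOn g (Ioo 0 R))
    (hgi : IntegrableOn (fun r => w r ^ e * r ^ 4 * g r ^ 2) (Ioo 0 R)) :
    IntegrableOn (fun r => (R - r) ^ e * g r ^ 2) (Ioo a R) := by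
  have hsub : Ioo a R ⊆ Ioo 0 R := Ioo_subset_Ioo_left ha.le
  refine Integrable.mono' ((hgi.mono_set hsub).const_mul (m ^ e * a ^ 4)⁻¹) ?_
    (ae_restrict_of_forall_mem measurableSet_Ioo ?_)
  · refine ContinuousOn.aestronglyMeasurable ?_ measurableSet_Ioo
    exact ((continuousOn_const.sub continuousOn_id).rpow_const fun _ _ => Or.inr he).mul
      ((hg.mono hsub).pow 2)
  · intro r hr
    have hr0 : 0 < R - r := sub_pos.2 hr.2
    have h1 := rpow_le_rpow (by positivity) (hw r (Ioo_subset_Ico_self hr)) he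
    rw [mul_rpow hm.le hr0.le] at h1
    have hme : 0 < m ^ e := rpow_pos_of_pos hm _
    rw [Real.norm_eq_abs, abs_of_nonneg (by positivity), inv_mul_eq_div,
      le_div_iff₀ (by positivity)]
    calc (R - r) ^ e * g r ^ 2 * (m ^ e * a ^ 4) = (m ^ e * (R - r) ^ e) * a ^ 4 * g r ^ 2 := by ring
      _ ≤ w r ^ e * r ^ 4 * g r ^ 2 := by
        have := hr.1.le
        have : 0 ≤ w r ^ e := le_trans (by positivity) h1
        gcongr

/-- Improved integrability of the growing mode: for `0 ≤ β ≤ α` both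
`∫ w^{α−β} r⁴ φ₀²` and `∫ w^{1+α−β} r⁴ φ₀'²` are finite, and for `z > 1`,
`∫ w^{z−2} r⁴ φ₀² < ∞`. -/
theorem growingMode_integrability
    (α c R : ℝ) (hα : 3 < α) (hα' : α < 5) (hc : 0 < c) (hR : 0 < R)
    (w : ℝ → ℝ)
    (hw_cont : ContinuousOn w (Set.Icc 0 R))
    (hw_smooth : ContDiffOn ℝ (⊤ : ℕ∞) w (Set.Ico 0 R))
    (hw0 : w 0 = 1) (hw'0 : deriv w 0 = 0)
    (hw_pos : ∀ r, 0 ≤ r → r < R → 0 < w r)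
    (hwR : w R = 0)
    (hw_dec : ∀ r, 0 < r → r < R → deriv w r < 0)
    (hw_pv : ∃ w'R : ℝ, w'R < 0 ∧
      Filter.Tendsto (deriv w) (nhdsWithin R (Set.Iio R)) (nhds w'R))
    (hw_ode : ∀ r, 0 < r → r < R →
      deriv (deriv w) r + (2 / r) * deriv w r + c * w r ^ α = 0)
    (φ₀ : ℝ → ℝ) (μ₀ : ℝ) (hμ₀ : 0 < μ₀)
    (hφ_smooth : ContDiffOn ℝ (⊤ : ℕ∞) φ₀ (Set.Ioo 0 R))
    (hφ_norm : FiniteNorm α R w φ₀)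
    (hφ_eq : ∀ r ∈ Set.Ioo (0:ℝ) R,
      μ₀ * w r ^ α * r ^ 4 * φ₀ r =
        ((1 + α) / α) * deriv (fun s => w s ^ (1 + α) * s ^ 4 * deriv φ₀ s) r
          - (4 - 3 * (1 + α) / α) * deriv (fun s => w s ^ (1 + α)) r * r ^ 3 * φ₀ r) :
    (∀ β : ℝ, 0 ≤ β → β ≤ α →
        MeasureTheory.IntegrableOn (fun r => w r ^ (α - β) * r ^ 4 * (φ₀ r) ^ 2)
          (Set.Ioo 0 R) ∧
        MeasureTheory.IntegrableOn (fun r => w r ^ (1 + α - β) * r ^ 4 * (deriv φ₀ r) ^ 2)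
          (Set.Ioo 0 R)) ∧
    (∀ z : ℝ, 1 < z →
        MeasureTheory.IntegrableOn (fun r => w r ^ (z - 2) * r ^ 4 * (φ₀ r) ^ 2)
          (Set.Ioo 0 R)) := by
  have hwd : ∀ r ∈ Ioo 0 R, DifferentiableAt ℝ w r := fun r hr =>
    (hw_smooth.contDiffAt (Ico_mem_nhds hr.1 hr.2)).differentiableAt (by simp)
  have hφd : ∀ r ∈ Ioo 0 R, HasDerivAt φ₀ (deriv φ₀ r) r := fun r hr =>
    ((hφ_smooth.contDiffAt (Ioo_mem_nhds hr.1 hr.2)).differentiableAt (by simp)).hasDerivAt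
  have hφ'_smooth : ContDiffOn ℝ 1 (deriv φ₀) (Ioo 0 R) :=
    hφ_smooth.deriv_of_isOpen isOpen_Ioo (WithTop.coe_le_coe.2 le_top)
  have hφ'd : ∀ r ∈ Ioo 0 R, DifferentiableAt ℝ (deriv φ₀) r := fun r hr =>
    (hφ'_smooth.contDiffAt (Ioo_mem_nhds hr.1 hr.2)).differentiableAt (by simp)
  obtain ⟨w'R, hneg, hlim⟩ := hw_pv
  obtain ⟨a, m, M, ha, haR, hm, hM, hw, hw'⟩ :=
    exists_linear_bounds_near_vacuum hR hw_cont hwd hwR hneg hlim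
  have hsub : ∀ r ∈ Ico a R, r ∈ Ioo 0 R := fun r hr => ⟨ha.trans_le hr.1, hr.2⟩
  have hα0 : 0 < α := by linarith
  set κ := 4 - 3 * (1 + α) / α with hκ
  have hFd : ∀ r ∈ Ico a R,
      DifferentiableAt ℝ (fun s => w s ^ (1 + α) * s ^ 4 * deriv φ₀ s) r := fun r hr =>
    (((hwd r (hsub r hr)).rpow_const
      (Or.inl (hw_pos r (hsub r hr).1.le hr.2).ne')).mul (differentiableAt_id.pow 4)).mul
      (hφ'd r (hsub r hr))
  have hFb : ∀ r ∈ Ico a R, |deriv (fun s => w s ^ (1 + α) * s ^ 4 * deriv φ₀ s) r| ≤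
      α / (1 + α) * M ^ α * (μ₀ * R ^ 4 + |κ| * (M * (1 + α)) * R ^ 3)
        * ((R - r) ^ α * |φ₀ r|) := by
    intro r hr
    have hr0 := (hsub r hr).1
    have hRr : 0 < R - r := sub_pos.2 hr.2
    have hwr := hw_pos r hr0.le hr.2
    have hd : deriv (fun s => w s ^ (1 + α)) r = deriv w r * (1 + α) * w r ^ α := by
      rw [((hwd r (hsub r hr)).hasDerivAt.rpow_const (Or.inl hwr.ne')).deriv,
        add_sub_cancel_left]
    have heq := hφ_eq r (hsub r hr)
    rw [hd] at heq
    have hF : deriv (fun s => w s ^ (1 + α) * s ^ 4 * deriv φ₀ s) r =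
        α / (1 + α) * w r ^ α * (μ₀ * r ^ 4 + κ * (deriv w r * (1 + α)) * r ^ 3) * φ₀ r := by
      have h : (1 + α) / α * deriv (fun s => w s ^ (1 + α) * s ^ 4 * deriv φ₀ s) r =
          w r ^ α * (μ₀ * r ^ 4 + κ * (deriv w r * (1 + α)) * r ^ 3) * φ₀ r := by
        linear_combination -heq
      rw [mul_assoc (α / (1 + α)), mul_assoc (α / (1 + α)), ← h]
      field_simp
    have hwα : w r ^ α ≤ M ^ α * (R - r) ^ α := by
      rw [← mul_rpow hM.le hRr.le]
      exact rpow_le_rpow hwr.le (hw r hr).2 hα0.le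
    have hin : |μ₀ * r ^ 4 + κ * (deriv w r * (1 + α)) * r ^ 3| ≤
        μ₀ * R ^ 4 + |κ| * (M * (1 + α)) * R ^ 3 := by
      refine (abs_add_le _ _).trans ?_
      rw [abs_mul, abs_mul, abs_mul, abs_mul, abs_of_pos hμ₀, abs_of_pos (pow_pos hr0 4),
        abs_of_pos (pow_pos hr0 3), abs_of_pos (show 0 < 1 + α by linarith)]
      have := hw' r hr
      have := hr.2.le
      gcongr
    have hwα0 : 0 < w r ^ α := rpow_pos_of_pos hwr _
    rw [hF, abs_mul, abs_mul, abs_of_pos (show 0 < α / (1 + α) * w r ^ α by positivity)]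
    calc α / (1 + α) * w r ^ α * |μ₀ * r ^ 4 + κ * (deriv w r * (1 + α)) * r ^ 3| * |φ₀ r|
        ≤ α / (1 + α) * (M ^ α * (R - r) ^ α) *
          (μ₀ * R ^ 4 + |κ| * (M * (1 + α)) * R ^ 3) * |φ₀ r| := by gcongr
      _ = _ := by ring
  have hFabs : ∀ r ∈ Ico a R, |w r ^ (1 + α) * r ^ 4 * deriv φ₀ r| =
      w r ^ (1 + α) * r ^ 4 * |deriv φ₀ r| := fun r hr => by
    have hr0 := (hsub r hr).1
    have := rpow_pos_of_pos (hw_pos r hr0.le hr.2) (1 + α)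
    rw [abs_mul, abs_of_pos (by positivity)]
  have hKb : ∀ r ∈ Ico a R, |deriv φ₀ r| ≤
      (m ^ (1 + α) * a ^ 4)⁻¹ * ((R - r) ^ (-(1 + α)) * |w r ^ (1 + α) * r ^ 4 * deriv φ₀ r|) := by
    intro r hr
    have hRr : 0 < R - r := sub_pos.2 hr.2
    have h1 := rpow_le_rpow (by positivity) (hw r hr).1 (show 0 ≤ 1 + α by linarith)
    rw [mul_rpow hm.le hRr.le] at h1
    have hx : 0 < (R - r) ^ (1 + α) := rpow_pos_of_pos hRr _
    have hmα : 0 < m ^ (1 + α) := rpow_pos_of_pos hm _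
    rw [hFabs r hr, rpow_neg hRr.le, ← mul_assoc, ← mul_inv, inv_mul_eq_div,
      le_div_iff₀ (by positivity)]
    calc |deriv φ₀ r| * (m ^ (1 + α) * a ^ 4 * (R - r) ^ (1 + α))
        = m ^ (1 + α) * (R - r) ^ (1 + α) * a ^ 4 * |deriv φ₀ r| := by ring
      _ ≤ w r ^ (1 + α) * r ^ 4 * |deriv φ₀ r| := by
        have := hr.1
        have : 0 ≤ w r ^ (1 + α) := le_trans (by positivity) h1
        gcongr
  have hLb : ∀ r ∈ Ico a R, |w r ^ (1 + α) * r ^ 4 * deriv φ₀ r| ≤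
      M ^ (1 + α) * R ^ 4 * ((R - r) ^ (1 + α) * |deriv φ₀ r|) := by
    intro r hr
    have hr0 := (hsub r hr).1
    have hRr : 0 < R - r := sub_pos.2 hr.2
    have h1 := rpow_le_rpow (hw_pos r hr0.le hr.2).le (hw r hr).2 (show 0 ≤ 1 + α by linarith)
    rw [mul_rpow hM.le hRr.le] at h1
    rw [hFabs r hr]
    calc w r ^ (1 + α) * r ^ 4 * |deriv φ₀ r|
        ≤ M ^ (1 + α) * (R - r) ^ (1 + α) * R ^ 4 * |deriv φ₀ r| := by
          have := hr.2.le
          gcongr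
      _ = _ := by ring
  obtain ⟨C, hC⟩ := exists_bound_of_singular_system hα hα' haR (by positivity) (by positivity)
    hFd (fun r hr => hφd r (hsub r hr)) hFb hKb hLb
    (integrableOn_sub_rpow_mul_sq_of_weight ha hm hα0.le (fun r hr => (hw r hr).1)
      hφ_smooth.continuousOn hφ_norm.2.2)
    (integrableOn_sub_rpow_mul_sq_of_weight ha hm (by linarith) (fun r hr => (hw r hr).1)
      hφ'_smooth.continuousOn hφ_norm.1)
  have hφ_int : ∀ e : ℝ, -1 < e →
      IntegrableOn (fun r => w r ^ e * r ^ 4 * φ₀ r ^ 2) (Ioo 0 R) := fun e he =>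
    integrableOn_weight_of_bounded ha haR hm hM hw_cont hw_pos hw hφ_smooth.continuousOn
      (fun r hr => (hC r hr).1) hφ_norm.2.2 he
  have hφ'_int : ∀ e : ℝ, -1 < e →
      IntegrableOn (fun r => w r ^ e * r ^ 4 * deriv φ₀ r ^ 2) (Ioo 0 R) := fun e he =>
    integrableOn_weight_of_bounded ha haR hm hM hw_cont hw_pos hw hφ'_smooth.continuousOn
      (fun r hr => (hC r hr).2) hφ_norm.1 he
  exact ⟨fun β _ hβ => ⟨hφ_int _ (by linarith), hφ'_int _ (by linarith)⟩,
    fun z hz => hφ_int _ (by linarith)⟩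
end

section
/- Let 3 < α < 5, let w be a Lane-Emden enthalpy profile, and let φ₀ be a growing-mode profile with eigenvalue μ₀ > 0. Then for every integer k with 1 ≤ k ≤ 2α + 1, the integral ∫₀^R w^{1+α+k} r⁴ |(∂_r^{k+1} φ₀)(r)|² dr is finite. -/
open MeasureTheory Real Filter Set

/-- The first `N` derivatives of `f` are dominated on `s`, up to constants, by the weights
`W 0, …, W N`. -/
def DerivControl (s : Set ℝ) (N : ℕ) (W : ℕ → ℝ → ℝ) (f : ℝ → ℝ) : Prop :=
  ∀ i ≤ N, ∃ C, ∀ r ∈ s, |iteratedDeriv i f r| ≤ C * W i r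

namespace DerivControl

variable {s : Set ℝ} {N : ℕ} {V W X : ℕ → ℝ → ℝ} {f g : ℝ → ℝ}

theorem bound (h : DerivControl s N W f) : ∃ C, ∀ r ∈ s, |f r| ≤ C * W 0 r := by
  simpa using h 0 (Nat.zero_le _)

theorem zero_iff : DerivControl s 0 W f ↔ ∃ C, ∀ r ∈ s, |f r| ≤ C * W 0 r := by
  refine ⟨bound, fun h i hi => ?_⟩
  obtain rfl : i = 0 := by omega
  simpa using h

theorem succ_iff : DerivControl s (N + 1) W f ↔
    (∃ C, ∀ r ∈ s, |f r| ≤ C * W 0 r) ∧ DerivControl s N (fun i => W (i + 1)) (deriv f) := by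
  constructor
  · refine fun h => ⟨h.bound, fun i hi => ?_⟩
    simpa [iteratedDeriv_succ'] using h (i + 1) (by omega)
  · rintro ⟨h0, h1⟩ i hi
    cases i with
    | zero => simpa using h0
    | succ i => simpa [iteratedDeriv_succ'] using h1 i (by omega)

theorem of_le {M : ℕ} (h : DerivControl s N W f) (hM : M ≤ N) : DerivControl s M W f :=
  fun i hi => h i (hi.trans hM)

theorem iteratedDeriv_shift {j : ℕ} (h : DerivControl s (N + j) W f) :
    DerivControl s N (fun i => W (i + j)) (iteratedDeriv j f) := by
  intro i hi
  obtain ⟨C, hC⟩ := h (i + j) (by omega)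
  refine ⟨C, fun r hr => ?_⟩
  have : iteratedDeriv i (iteratedDeriv j f) = iteratedDeriv (i + j) f := by
    simp only [iteratedDeriv_eq_iterate, Function.iterate_add_apply]
  simpa [this] using hC r hr

theorem weight_mono (h : DerivControl s N V f) (hV : ∀ i, ∀ r ∈ s, 0 ≤ V i r)
    (hVW : ∀ i, ∀ r ∈ s, V i r ≤ W i r) : DerivControl s N W f := by
  intro i hi
  obtain ⟨C, hC⟩ := h i hi
  refine ⟨|C|, fun r hr => (hC r hr).trans ?_⟩
  have h1 := hV i r hr
  have h2 := hVW i r hr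
  have h3 := le_abs_self C
  have h4 := abs_nonneg C
  nlinarith

theorem congr (hs : IsOpen s) (h : DerivControl s N W f) (hfg : EqOn f g s) :
    DerivControl s N W g := by
  intro i hi
  obtain ⟨C, hC⟩ := h i hi
  refine ⟨C, fun r hr => ?_⟩
  rw [← Filter.EventuallyEq.iteratedDeriv_eq i (hfg.eventuallyEq_of_mem (hs.mem_nhds hr))]
  exact hC r hr

theorem add (hs : IsOpen s) (hf : ContDiffOn ℝ (⊤ : ℕ∞) f s) (hg : ContDiffOn ℝ (⊤ : ℕ∞) g s)
    (h : DerivControl s N W f) (h' : DerivControl s N W g) :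
    DerivControl s N W (fun r => f r + g r) := by
  intro i hi
  obtain ⟨C, hC⟩ := h i hi
  obtain ⟨D, hD⟩ := h' i hi
  refine ⟨C + D, fun r hr => ?_⟩
  have e : iteratedDeriv i (f + g) r = iteratedDeriv i f r + iteratedDeriv i g r :=
    iteratedDeriv_add ((hf.contDiffAt (hs.mem_nhds hr)).of_le (by exact_mod_cast le_top))
      ((hg.contDiffAt (hs.mem_nhds hr)).of_le (by exact_mod_cast le_top))
  change |iteratedDeriv i (f + g) r| ≤ _
  rw [e, add_mul]
  exact (abs_add_le _ _).trans (add_le_add (hC r hr) (hD r hr))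

theorem const_mul (c : ℝ) (h : DerivControl s N W f) :
    DerivControl s N W (fun r => c * f r) := by
  intro i hi
  obtain ⟨C, hC⟩ := h i hi
  refine ⟨|c| * C, fun r hr => ?_⟩
  rw [iteratedDeriv_const_mul_field, abs_mul, mul_assoc]
  exact mul_le_mul_of_nonneg_left (hC r hr) (abs_nonneg c)

theorem sub (hs : IsOpen s) (hf : ContDiffOn ℝ (⊤ : ℕ∞) f s) (hg : ContDiffOn ℝ (⊤ : ℕ∞) g s)
    (h : DerivControl s N W f) (h' : DerivControl s N W g) :
    DerivControl s N W (fun r => f r - g r) := by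
  have := h.add hs hf (contDiffOn_const.mul hg) (h'.const_mul (-1))
  simpa [sub_eq_add_neg] using this

theorem mul (hs : IsOpen s) (hf : ContDiffOn ℝ (⊤ : ℕ∞) f s) (hg : ContDiffOn ℝ (⊤ : ℕ∞) g s)
    (hV : ∀ i, ∀ r ∈ s, 0 ≤ V i r) (hW : ∀ i, ∀ r ∈ s, 0 ≤ W i r)
    (hX : ∀ i j, ∀ r ∈ s, V i r * W j r ≤ X (i + j) r)
    (h : DerivControl s N V f) (h' : DerivControl s N W g) :
    DerivControl s N X (fun r => f r * g r) := by
  induction N generalizing f g V W X with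
  | zero =>
    rw [zero_iff] at *
    obtain ⟨C, hC⟩ := h
    obtain ⟨D, hD⟩ := h'
    refine ⟨|C| * |D|, fun r hr => ?_⟩
    have h1 : |f r| ≤ |C| * V 0 r :=
      (hC r hr).trans (mul_le_mul_of_nonneg_right (le_abs_self C) (hV 0 r hr))
    have h2 : |g r| ≤ |D| * W 0 r :=
      (hD r hr).trans (mul_le_mul_of_nonneg_right (le_abs_self D) (hW 0 r hr))
    calc |f r * g r| = |f r| * |g r| := abs_mul _ _
      _ ≤ (|C| * V 0 r) * (|D| * W 0 r) :=
        mul_le_mul h1 h2 (abs_nonneg _) (mul_nonneg (abs_nonneg _) (hV 0 r hr))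
      _ = |C| * |D| * (V 0 r * W 0 r) := by ring
      _ ≤ |C| * |D| * X 0 r := mul_le_mul_of_nonneg_left (hX 0 0 r hr) (by positivity)
  | succ N ih =>
    have hf' : ContDiffOn ℝ (⊤ : ℕ∞) (deriv f) s := hf.deriv_of_isOpen hs (by simp)
    have hg' : ContDiffOn ℝ (⊤ : ℕ∞) (deriv g) s := hg.deriv_of_isOpen hs (by simp)
    rw [succ_iff]
    refine ⟨(ih hf hg hV hW hX (h.of_le N.le_succ) (h'.of_le N.le_succ)).bound, ?_⟩
    have a := ih (X := fun i => X (i + 1)) hf' hg (fun i => hV (i + 1)) hW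
      (fun i j r hr => by
        have := hX (i + 1) j r hr
        rwa [show i + 1 + j = i + j + 1 by ring] at this)
      (succ_iff.1 h).2 (h'.of_le N.le_succ)
    have b := ih (X := fun i => X (i + 1)) hf hg' hV (fun i => hW (i + 1))
      (fun i j r hr => hX i (j + 1) r hr) (h.of_le N.le_succ) (succ_iff.1 h').2
    refine (a.add hs (hf'.mul hg) (hf.mul hg') b).congr hs fun r hr => ?_
    have df := (hf.contDiffAt (hs.mem_nhds hr)).differentiableAt (by simp)
    have dg := (hg.contDiffAt (hs.mem_nhds hr)).differentiableAt (by simp)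
    exact (deriv_fun_mul df dg).symm

end DerivControl

theorem rpow_le_add_rpow {a b y : ℝ} (ha : 0 < a) (hay : a ≤ y) (hyb : y ≤ b) (x : ℝ) :
    y ^ x ≤ a ^ x + b ^ x := by
  have h1 : 0 ≤ a ^ x := rpow_nonneg ha.le x
  have h2 : 0 ≤ b ^ x := rpow_nonneg (by linarith) x
  rcases le_total 0 x with hx | hx
  · linarith [rpow_le_rpow (by linarith) hyb hx]
  · linarith [rpow_le_rpow_of_nonpos ha hay hx]

/-- The weight `r ^ (-p) * w ^ (-(σ + (i - t)₊))`. -/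
noncomputable def profileWeight (w : ℝ → ℝ) (p σ t : ℝ) (i : ℕ) (r : ℝ) : ℝ :=
  r ^ (-p) * w r ^ (-(σ + max 0 ((i : ℝ) - t)))

/-- The Lane-Emden enthalpy profiles with a physical vacuum boundary. -/
structure IsEnthalpyProfile (α c R : ℝ) (w : ℝ → ℝ) : Prop where
  three_lt : 3 < α
  R_pos : 0 < R
  cont : ContinuousOn w (Icc 0 R)
  smooth : ContDiffOn ℝ (⊤ : ℕ∞) w (Ico 0 R)
  apply_zero : w 0 = 1
  pos' : ∀ r, 0 ≤ r → r < R → 0 < w r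
  apply_R : w R = 0
  deriv_neg : ∀ r, 0 < r → r < R → deriv w r < 0
  vacuum : ∃ w'R : ℝ, w'R < 0 ∧ Tendsto (deriv w) (nhdsWithin R (Iio R)) (nhds w'R)
  ode : ∀ r, 0 < r → r < R → deriv (deriv w) r + (2 / r) * deriv w r + c * w r ^ α = 0

namespace IsEnthalpyProfile

variable {α c R : ℝ} {w : ℝ → ℝ}

theorem pos (h : IsEnthalpyProfile α c R w) {r : ℝ} (hr : r ∈ Ioo 0 R) : 0 < w r :=
  h.pos' r hr.1.le hr.2

theorem smoothOn (h : IsEnthalpyProfile α c R w) : ContDiffOn ℝ (⊤ : ℕ∞) w (Ioo 0 R) :=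
  h.smooth.mono Ioo_subset_Ico_self

theorem smoothOn_deriv (h : IsEnthalpyProfile α c R w) :
    ContDiffOn ℝ (⊤ : ℕ∞) (deriv w) (Ioo 0 R) :=
  h.smoothOn.deriv_of_isOpen isOpen_Ioo (by simp)

theorem hasDerivAt (h : IsEnthalpyProfile α c R w) {r : ℝ} (hr : r ∈ Ioo 0 R) :
    HasDerivAt w (deriv w r) r :=
  ((h.smoothOn.contDiffAt (isOpen_Ioo.mem_nhds hr)).differentiableAt (by simp)).hasDerivAt

theorem hasDerivAt_rpow (h : IsEnthalpyProfile α c R w) (x : ℝ) {r : ℝ} (hr : r ∈ Ioo 0 R) :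
    HasDerivAt (fun s => w s ^ x) (deriv w r * x * w r ^ (x - 1)) r :=
  (h.hasDerivAt hr).rpow_const (Or.inl (h.pos hr).ne')

theorem smoothOn_rpow (h : IsEnthalpyProfile α c R w) (x : ℝ) :
    ContDiffOn ℝ (⊤ : ℕ∞) (fun r => w r ^ x) (Ioo 0 R) :=
  h.smoothOn.rpow_const_of_ne fun _ hr => (h.pos hr).ne'

theorem antitoneOn (h : IsEnthalpyProfile α c R w) : AntitoneOn w (Icc 0 R) := by
  refine antitoneOn_of_deriv_nonpos (convex_Icc 0 R) h.cont ?_ ?_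
  · rw [interior_Icc]
    exact h.smoothOn.differentiableOn (by simp)
  · rw [interior_Icc]
    exact fun r hr => (h.deriv_neg r hr.1 hr.2).le

theorem le_one (h : IsEnthalpyProfile α c R w) {r : ℝ} (hr : r ∈ Ioo 0 R) : w r ≤ 1 := by
  rw [← h.apply_zero]
  exact h.antitoneOn ⟨le_rfl, h.R_pos.le⟩ ⟨hr.1.le, hr.2.le⟩ hr.1.le

theorem tendsto_zero (h : IsEnthalpyProfile α c R w) :
    Tendsto w (nhdsWithin R (Iio R)) (nhds 0) := by
  have := h.cont R ⟨h.R_pos.le, le_rfl⟩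
  rw [ContinuousWithinAt, h.apply_R] at this
  exact (this.mono_left (nhdsWithin_mono _ Ioc_subset_Icc_self)).mono_left
    ((nhdsWithin_le_iff.2 (mem_of_superset (Ioo_mem_nhdsLT h.R_pos) Ioo_subset_Ioc_self)))

theorem exists_slope (h : IsEnthalpyProfile α c R w) :
    ∃ d ∈ Ioo 0 R, ∃ m > 0, ∃ M, ∀ r ∈ Ico d R, deriv w r ≤ -m ∧ -M ≤ deriv w r := by
  obtain ⟨v, hv, hlim⟩ := h.vacuum
  have h1 : ∀ᶠ r in nhdsWithin R (Iio R), deriv w r < v / 2 :=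
    hlim.eventually_lt_const (by linarith)
  have h2 : ∀ᶠ r in nhdsWithin R (Iio R), 2 * v < deriv w r :=
    hlim.eventually_const_lt (by linarith)
  obtain ⟨d, hd, hsub⟩ := mem_nhdsLT_iff_exists_Ico_subset.1 (h1.and h2)
  refine ⟨max d (R / 2), ⟨lt_max_of_lt_right (by linarith [h.R_pos]),
    max_lt hd (by linarith [h.R_pos])⟩, -v / 2, by linarith, -2 * v, fun r hr => ?_⟩
  have := hsub ⟨(le_max_left _ _).trans hr.1, hr.2⟩
  exact ⟨by linarith [this.1], by linarith [this.2]⟩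

theorem exists_rpow_le (h : IsEnthalpyProfile α c R w) {d : ℝ} (hd : d ∈ Ioo 0 R) (x : ℝ) :
    ∃ K, 0 < K ∧ ∀ r ∈ Ioc 0 d, w r ^ x ≤ K := by
  refine ⟨w d ^ x + 1 ^ x, by have := rpow_pos_of_pos (h.pos hd) x; positivity, fun r hr => ?_⟩
  have hrI : r ∈ Ioo 0 R := ⟨hr.1, hr.2.trans_lt hd.2⟩
  exact rpow_le_add_rpow (h.pos hd)
    (h.antitoneOn ⟨hr.1.le, hrI.2.le⟩ ⟨hd.1.le, hd.2.le⟩ hr.2) (h.le_one hrI) x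

theorem weight_nonneg (h : IsEnthalpyProfile α c R w) (p σ t : ℝ) (i : ℕ) {r : ℝ}
    (hr : r ∈ Ioo 0 R) : 0 ≤ profileWeight w p σ t i r :=
  mul_nonneg (rpow_nonneg hr.1.le _) (rpow_nonneg (h.pos hr).le _)

theorem weight_mono (h : IsEnthalpyProfile α c R w) (p σ : ℝ) {t t' : ℝ} {i i' : ℕ}
    (ht : (i : ℝ) - t ≤ i' - t') {r : ℝ} (hr : r ∈ Ioo 0 R) :
    profileWeight w p σ t i r ≤ profileWeight w p σ t' i' r := by
  refine mul_le_mul_of_nonneg_left ?_ (rpow_nonneg hr.1.le _)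
  refine rpow_le_rpow_of_exponent_ge (h.pos hr) (h.le_one hr) ?_
  have := max_le_max (le_refl (0 : ℝ)) ht
  linarith

theorem weight_mul_le (h : IsEnthalpyProfile α c R w) (p σ : ℝ) {t t' t'' : ℝ} {i j k : ℕ}
    (ht : max 0 ((i : ℝ) - t) + max 0 ((j : ℝ) - t') ≤ max 0 ((k : ℝ) - t'')) {r : ℝ}
    (hr : r ∈ Ioo 0 R) :
    profileWeight w 0 0 t i r * profileWeight w p σ t' j r ≤ profileWeight w p σ t'' k r := by
  have hw := h.pos hr
  have e : profileWeight w 0 0 t i r * profileWeight w p σ t' j r =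
      r ^ (-p) * w r ^ (-(0 + max 0 ((i : ℝ) - t)) + -(σ + max 0 ((j : ℝ) - t'))) := by
    rw [profileWeight, profileWeight, rpow_add hw]
    simp only [neg_zero, rpow_zero, one_mul]
    ring
  rw [e, profileWeight]
  refine mul_le_mul_of_nonneg_left ?_ (rpow_nonneg hr.1.le _)
  refine rpow_le_rpow_of_exponent_ge hw (h.le_one hr) ?_
  linarith

theorem one_le_weight (h : IsEnthalpyProfile α c R w) (t : ℝ) (i : ℕ) {r : ℝ}
    (hr : r ∈ Ioo 0 R) : 1 ≤ profileWeight w 0 0 t i r := by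
  rw [profileWeight, neg_zero, rpow_zero, one_mul]
  exact one_le_rpow_of_pos_of_le_one_of_nonpos (h.pos hr) (h.le_one hr) (by simp)

theorem derivControl_of_bounded (h : IsEnthalpyProfile α c R w) {N : ℕ} {f : ℝ → ℝ} {s : Set ℝ}
    (hs : s ⊆ Ioo 0 R)
    (hf : DerivControl s N (fun _ _ => 1) f) (t : ℝ) :
    DerivControl s N (profileWeight w 0 0 t) f :=
  hf.weight_mono (fun _ _ _ => zero_le_one) fun i _ hr => h.one_le_weight t i (hs hr)

theorem derivControl_rpow (h : IsEnthalpyProfile α c R w) {s : Set ℝ} (hso : IsOpen s)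
    (hs : s ⊆ Ioo 0 R) {N : ℕ} (hw' : DerivControl s N (profileWeight w 0 0 (α + 1)) (deriv w))
    (x : ℝ) : DerivControl s (N + 1) (fun i r => w r ^ (x - i)) (fun r => w r ^ x) := by
  have hnn : ∀ (x : ℝ) (i : ℕ), ∀ r ∈ s, 0 ≤ w r ^ (x - i) := fun x i r hr =>
    rpow_nonneg (h.pos (hs hr)).le _
  have base : ∀ x : ℝ, ∃ C, ∀ r ∈ s, |w r ^ x| ≤ C * w r ^ (x - ((0 : ℕ) : ℝ)) := fun x =>
    ⟨1, fun r hr => by simp [abs_of_nonneg (rpow_nonneg (h.pos (hs hr)).le x)]⟩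
  suffices H : ∀ n ≤ N + 1, ∀ x : ℝ,
      DerivControl s n (fun i r => w r ^ (x - i)) (fun r => w r ^ x) from H _ le_rfl x
  intro n
  induction n with
  | zero => exact fun _ x => DerivControl.zero_iff.2 (base x)
  | succ n ih =>
    intro hn x
    refine DerivControl.succ_iff.2 ⟨base x, ?_⟩
    have key := DerivControl.mul (X := fun i r => w r ^ (x - (i + 1 : ℕ))) hso
      (h.smoothOn_deriv.mono hs) ((h.smoothOn_rpow (x - 1)).mono hs)
      (fun i r hr => h.weight_nonneg 0 0 (α + 1) i (hs hr)) (fun i => hnn (x - 1) i)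
      (fun i j r hr => by
        have hp := h.pos (hs hr)
        rw [profileWeight, neg_zero, rpow_zero, one_mul, ← rpow_add hp]
        refine rpow_le_rpow_of_exponent_ge hp (h.le_one (hs hr)) ?_
        have : max 0 ((i : ℝ) - (α + 1)) ≤ i :=
          max_le (Nat.cast_nonneg i) (by linarith [h.three_lt])
        push_cast
        linarith)
      (hw'.of_le (by omega : n ≤ N)) (ih (by omega) (x - 1))
    refine (key.const_mul x).congr hso fun r hr => ?_
    rw [(h.hasDerivAt_rpow x (hs hr)).deriv]
    ring

theorem derivControl_id {s : Set ℝ} (hs : s ⊆ Ioo 0 R) (N : ℕ) :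
    DerivControl s N (fun _ _ => 1) (fun r : ℝ => r) := by
  intro i _
  refine ⟨max R 1, fun r hr => ?_⟩
  have hr' := hs hr
  rw [iteratedDeriv_fun_id]
  split_ifs with h0 h1
  · rw [abs_of_pos hr'.1]
    simp [hr'.2.le]
  · simp
  · simp

theorem derivControl_two_div {d : ℝ} (hd : 0 < d) (N : ℕ) :
    DerivControl (Ioo d R) N (fun _ _ => 1) (fun r : ℝ => 2 / r) := by
  intro i _
  have hc : ContinuousOn (iteratedDeriv i (fun r : ℝ => 2 / r)) (Icc d R) := by
    have hsm : ContDiffOn ℝ (⊤ : ℕ∞) (fun r : ℝ => 2 / r) (Ioi 0) :=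
      contDiffOn_const.div contDiffOn_id fun r hr => (mem_Ioi.1 hr).ne'
    refine ((hsm.continuousOn_iteratedDerivWithin (m := i) (by exact_mod_cast le_top)
      isOpen_Ioi.uniqueDiffOn).congr (iteratedDerivWithin_of_isOpen isOpen_Ioi).symm).mono ?_
    exact fun r hr => hd.trans_le hr.1
  obtain ⟨C, hC⟩ := isCompact_Icc.exists_bound_of_continuousOn hc
  exact ⟨C, fun r hr => by simpa using hC r ⟨hr.1.le, hr.2.le⟩⟩

theorem exists_iteratedDeriv_bound (h : IsEnthalpyProfile α c R w) {d : ℝ} (hd : d ∈ Ioo 0 R)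
    (i : ℕ) : ∃ C, ∀ r ∈ Ioc 0 d, |iteratedDeriv i w r| ≤ C := by
  have hu : UniqueDiffOn ℝ (Ico 0 R) := uniqueDiffOn_Ico 0 R
  have hc := (h.smooth.continuousOn_iteratedDerivWithin (m := i)
    (by exact_mod_cast le_top) hu).mono (Icc_subset_Ico_right hd.2)
  obtain ⟨C, hC⟩ := isCompact_Icc.exists_bound_of_continuousOn hc
  refine ⟨C, fun r hr => ?_⟩
  have hrI : r ∈ Ioo 0 R := ⟨hr.1, hr.2.trans_lt hd.2⟩
  rw [← iteratedDerivWithin_eq_iteratedDeriv hu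
    ((h.smoothOn.contDiffAt (isOpen_Ioo.mem_nhds hrI)).of_le (by exact_mod_cast le_top))
    (Ioo_subset_Ico_self hrI)]
  exact hC r ⟨hr.1.le, hr.2⟩

theorem derivControl_near_boundary (h : IsEnthalpyProfile α c R w) {d : ℝ} (hd : d ∈ Ioo 0 R)
    {M : ℝ} (hM : ∀ r ∈ Ioo d R, |deriv w r| ≤ M) (N : ℕ) :
    DerivControl (Ioo d R) N (profileWeight w 0 0 (α + 2)) w := by
  have hs : Ioo d R ⊆ Ioo 0 R := Ioo_subset_Ioo_left hd.1.le
  have hα := h.three_lt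
  have shift : ∀ (N : ℕ) (t : ℝ) (f : ℝ → ℝ),
      DerivControl (Ioo d R) N (profileWeight w 0 0 t) f →
      DerivControl (Ioo d R) N (fun i => profileWeight w 0 0 (t + 1) (i + 1)) f :=
    fun N t f hf => hf.weight_mono (fun i r hr => h.weight_nonneg 0 0 t i (hs hr))
      fun i r hr => h.weight_mono 0 0 (by push_cast; linarith) (hs hr)
  have b0 : ∃ C, ∀ r ∈ Ioo d R, |w r| ≤ C * profileWeight w 0 0 (α + 2) 0 r :=
    ⟨1, fun r hr => by
      rw [abs_of_pos (h.pos (hs hr)), one_mul]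
      exact (h.le_one (hs hr)).trans (h.one_le_weight _ _ (hs hr))⟩
  have b1 : ∃ C, ∀ r ∈ Ioo d R, |deriv w r| ≤ C * profileWeight w 0 0 (α + 1) 0 r :=
    ⟨M, fun r hr => (hM r hr).trans (le_mul_of_one_le_right
      ((abs_nonneg _).trans (hM r hr)) (h.one_le_weight _ _ (hs hr)))⟩
  have key : ∀ N, DerivControl (Ioo d R) N (profileWeight w 0 0 (α + 1)) (deriv w) := by
    intro N
    induction N with
    | zero => exact DerivControl.zero_iff.2 b1
    | succ N ih =>
      refine DerivControl.succ_iff.2 ⟨b1, shift N α _ ?_⟩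
      have hpow : DerivControl (Ioo d R) N (profileWeight w 0 0 α) (fun r => w r ^ α) := by
        refine ((h.derivControl_rpow isOpen_Ioo hs ih α).of_le N.le_succ).weight_mono
          (fun i r hr => rpow_nonneg (h.pos (hs hr)).le _) fun i r hr => ?_
        rw [profileWeight, neg_zero, rpow_zero, one_mul]
        refine rpow_le_rpow_of_exponent_ge (h.pos (hs hr)) (h.le_one (hs hr)) ?_
        linarith [le_max_right 0 ((i : ℝ) - α)]
      have hsm : ContDiffOn ℝ (⊤ : ℕ∞) (fun r : ℝ => 2 / r) (Ioo d R) :=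
        contDiffOn_const.div contDiffOn_id fun r hr => (hs hr).1.ne'
      have hdrag := DerivControl.mul (X := profileWeight w 0 0 α) isOpen_Ioo
        hsm (h.smoothOn_deriv.mono hs)
        (fun _ _ _ => zero_le_one) (fun i r hr => h.weight_nonneg 0 0 (α + 1) i (hs hr))
        (fun i j r hr => by
          rw [one_mul]
          exact h.weight_mono 0 0 (by push_cast; linarith [(Nat.cast_nonneg i : (0:ℝ) ≤ i)])
            (hs hr))
        (derivControl_two_div hd.1 N) ih
      refine ((hdrag.const_mul (-1)).sub isOpen_Ioo
        (contDiffOn_const.mul (hsm.mul (h.smoothOn_deriv.mono hs)))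
        (contDiffOn_const.mul ((h.smoothOn_rpow α).mono hs)) (hpow.const_mul c)).congr
        isOpen_Ioo fun r hr => ?_
      have := h.ode r (hs hr).1 (hs hr).2
      linarith
  refine DerivControl.of_le (DerivControl.succ_iff.2 ⟨b0, ?_⟩) N.le_succ
  have := shift N (α + 1) _ (key N)
  rwa [show α + 1 + 1 = α + 2 by ring] at this

theorem derivControl (h : IsEnthalpyProfile α c R w) (N : ℕ) :
    DerivControl (Ioo 0 R) N (profileWeight w 0 0 (α + 2)) w := by
  obtain ⟨d, hd, m, hm, M, hM⟩ := h.exists_slope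
  intro i hi
  obtain ⟨C, hC⟩ := h.exists_iteratedDeriv_bound hd i
  obtain ⟨D, hD⟩ := h.derivControl_near_boundary hd (M := M) (fun r hr => by
    have := hM r ⟨hr.1.le, hr.2⟩
    rw [abs_of_neg (by linarith [this.1])]
    linarith [this.2]) N i hi
  refine ⟨max C D, fun r hr => ?_⟩
  have hW := h.one_le_weight (α + 2) i hr
  rcases le_or_gt r d with hrd | hrd
  · have h1 := hC r ⟨hr.1, hrd⟩
    have h2 := (abs_nonneg _).trans h1
    have h3 := le_max_left C D
    nlinarith
  · exact (hD r ⟨hrd, hr.2⟩).trans (mul_le_mul_of_nonneg_right (le_max_right C D) (by linarith))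

theorem derivControl_deriv (h : IsEnthalpyProfile α c R w) (N : ℕ) :
    DerivControl (Ioo 0 R) N (profileWeight w 0 0 (α + 1)) (deriv w) :=
  (DerivControl.succ_iff.1 (h.derivControl (N + 1))).2.weight_mono
    (fun i r hr => h.weight_nonneg 0 0 (α + 2) (i + 1) hr)
    fun i r hr => h.weight_mono 0 0 (by push_cast; linarith) hr

theorem exists_bound_of_derivControl (h : IsEnthalpyProfile α c R w) {f : ℝ → ℝ}
    (hf : DerivControl (Ioo 0 R) 0 (profileWeight w 0 0 (α + 1)) f) :
    ∃ K, 0 < K ∧ ∀ r ∈ Ioo 0 R, |f r| ≤ K := by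
  obtain ⟨C, hC⟩ := hf.bound
  refine ⟨|C| + 1, by positivity, fun r hr => (hC r hr).trans ?_⟩
  have e : max 0 (((0 : ℕ) : ℝ) - (α + 1)) = 0 :=
    max_eq_left (by push_cast; linarith [h.three_lt])
  rw [profileWeight, e]
  simp only [neg_zero, rpow_zero, add_zero, mul_one]
  linarith [le_abs_self C]

end IsEnthalpyProfile

theorem abs_sub_le_sub_of_abs_deriv_le {D : Set ℝ} (hD : Convex ℝ D) {f f' Z Z' : ℝ → ℝ}
    (hf : ∀ r ∈ D, HasDerivAt f (f' r) r) (hZ : ∀ r ∈ D, HasDerivAt Z (Z' r) r)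
    (hle : ∀ r ∈ D, |f' r| ≤ Z' r) {x y : ℝ} (hx : x ∈ D) (hy : y ∈ D) (hxy : x ≤ y) :
    |f y - f x| ≤ Z y - Z x := by
  have h1 : MonotoneOn (fun r => Z r - f r) D :=
    monotoneOn_of_hasDerivWithinAt_nonneg hD
      (fun r hr => ((hZ r hr).sub (hf r hr)).continuousAt.continuousWithinAt)
      (fun r hr => ((hZ r (interior_subset hr)).sub (hf r (interior_subset hr))).hasDerivWithinAt)
      fun r hr => sub_nonneg.2 ((le_abs_self _).trans (hle r (interior_subset hr)))
  have h2 : MonotoneOn (fun r => Z r + f r) D :=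
    monotoneOn_of_hasDerivWithinAt_nonneg hD
      (fun r hr => ((hZ r hr).add (hf r hr)).continuousAt.continuousWithinAt)
      (fun r hr => ((hZ r (interior_subset hr)).add (hf r (interior_subset hr))).hasDerivWithinAt)
      fun r hr => by linarith [(neg_abs_le _).trans' (neg_le_neg (hle r (interior_subset hr)))]
  have h3 := h1 hx hy hxy
  have h4 := h2 hx hy hxy
  simp only at h3 h4
  exact abs_le.2 ⟨by linarith, by linarith⟩

theorem exists_tendsto_endpoints {a b : ℝ} (hab : a < b) {Y Y' : ℝ → ℝ}
    (hY : ∀ r ∈ Ioo a b, HasDerivAt Y (Y' r) r) (hint : IntegrableOn Y' (Ioo a b)) :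
    (∃ C, ∀ r ∈ Ioo a b, |Y r| ≤ C) ∧ (∃ y, Tendsto Y (nhdsWithin a (Ioi a)) (nhds y)) ∧
      ∃ y, Tendsto Y (nhdsWithin b (Iio b)) (nhds y) := by
  have hii : IntervalIntegrable Y' volume a b :=
    (intervalIntegrable_iff_integrableOn_Ioo_of_le hab.le).2 hint
  obtain ⟨x, hx⟩ := nonempty_Ioo.2 hab
  have hx' : x ∈ uIcc a b := by
    rw [uIcc_of_le hab.le]
    exact Ioo_subset_Icc_self hx
  have hc := intervalIntegral.continuousOn_primitive_interval' hii hx'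
  rw [uIcc_of_le hab.le] at hc
  have e : ∀ r ∈ Ioo a b, (Y x + ∫ t in x..r, Y' t) = Y r := by
    intro r hr
    have hsub : uIcc x r ⊆ Ioo a b := (ordConnected_Ioo).uIcc_subset hx hr
    rw [intervalIntegral.integral_eq_sub_of_hasDerivAt (fun t ht => hY t (hsub ht))]
    · ring
    · exact hii.mono_set (by
        rw [uIcc_of_le hab.le]
        exact hsub.trans Ioo_subset_Icc_self)
  refine ⟨?_, ?_, ?_⟩
  · obtain ⟨C, hC⟩ := isCompact_Icc.exists_bound_of_continuousOn
      ((continuousOn_const (c := Y x)).add hc)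
    refine ⟨C, fun r hr => ?_⟩
    rw [← e r hr]
    exact hC r (Ioo_subset_Icc_self hr)
  · refine ⟨Y x + ∫ t in x..a, Y' t, Tendsto.congr' ?_ (tendsto_const_nhds.add
      ((hc a (left_mem_Icc.2 hab.le)).mono_left
        (nhdsWithin_le_iff.2 (mem_of_superset (Ioo_mem_nhdsGT hab) Ioo_subset_Icc_self))))⟩
    filter_upwards [Ioo_mem_nhdsGT hab] with r hr using e r hr
  · refine ⟨Y x + ∫ t in x..b, Y' t, Tendsto.congr' ?_ (tendsto_const_nhds.add
      ((hc b (right_mem_Icc.2 hab.le)).mono_left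
        (nhdsWithin_le_iff.2 (mem_of_superset (Ioo_mem_nhdsLT hab) Ioo_subset_Icc_self))))⟩
    filter_upwards [Ioo_mem_nhdsLT hab] with r hr using e r hr

theorem integrableOn_Ioo_of_continuousOn_of_abs_le {a b C : ℝ} {f : ℝ → ℝ}
    (hf : ContinuousOn f (Ioo a b)) (hC : ∀ r ∈ Ioo a b, |f r| ≤ C) :
    IntegrableOn f (Ioo a b) :=
  Integrable.mono' (g := fun _ => C) (integrable_const C)
    (hf.aestronglyMeasurable measurableSet_Ioo)
    ((ae_restrict_iff' measurableSet_Ioo).2 (ae_of_all _ hC))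

theorem integrableOn_mul_of_integrableOn_mul_sq {a b : ℝ} {g f : ℝ → ℝ}
    (hg : ContinuousOn g (Ioo a b)) (hf : ContinuousOn f (Ioo a b))
    (hig : IntegrableOn g (Ioo a b)) (hgf : IntegrableOn (fun r => g r * f r ^ 2) (Ioo a b)) :
    IntegrableOn (fun r => g r * f r) (Ioo a b) := by
  refine Integrable.mono' (hgf.abs.add hig.abs)
    ((hg.mul hf).aestronglyMeasurable measurableSet_Ioo) (ae_of_all _ fun r => ?_)
  simp only [Real.norm_eq_abs, Pi.add_apply, abs_mul, abs_pow, sq_abs]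
  have h1 := abs_nonneg (g r)
  have h2 : |f r| ≤ f r ^ 2 + 1 := by
    rw [← sq_abs]
    nlinarith [sq_nonneg (|f r| - 1)]
  nlinarith

theorem exists_rpow_le_of_mem_Ico {d R : ℝ} (hd : 0 < d) (hdR : d < R) (x : ℝ) :
    ∃ K, 0 < K ∧ ∀ r ∈ Ico d R, r ^ x ≤ K :=
  ⟨d ^ x + R ^ x, add_pos (rpow_pos_of_pos hd x) (rpow_pos_of_pos (hd.trans hdR) x),
    fun _ hr => rpow_le_add_rpow hd hr.1 hr.2.le x⟩

namespace IsEnthalpyProfile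

variable {α c R : ℝ} {w : ℝ → ℝ}

theorem exists_bound_of_near (h : IsEnthalpyProfile α c R w) {d : ℝ} (hd : d ∈ Ioo 0 R)
    {f : ℝ → ℝ} {a e A B : ℝ}
    (h0 : ∀ r ∈ Ioc 0 d, |f r| ≤ A * r ^ a) (hR : ∀ r ∈ Ico d R, |f r| ≤ B * w r ^ e) :
    ∃ C, ∀ r ∈ Ioo 0 R, |f r| ≤ C * (r ^ a * w r ^ e) := by
  obtain ⟨K, hK0, hK⟩ := h.exists_rpow_le hd (-e)
  obtain ⟨L, hL0, hL⟩ := exists_rpow_le_of_mem_Ico hd.1 hd.2 (-a)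
  refine ⟨max (|A| * K) (|B| * L), fun r hr => ?_⟩
  have hw := h.pos hr
  have hra := rpow_pos_of_pos hr.1 a
  have hwe := rpow_pos_of_pos hw e
  rcases le_total r d with hrd | hrd
  · have h1 := hK r ⟨hr.1, hrd⟩
    have h2 : 1 ≤ K * w r ^ e := by
      have := mul_le_mul_of_nonneg_right h1 hwe.le
      rwa [← rpow_add hw, neg_add_cancel, rpow_zero] at this
    calc |f r| ≤ A * r ^ a := h0 r ⟨hr.1, hrd⟩
      _ ≤ |A| * r ^ a * 1 := by
        rw [mul_one]
        exact mul_le_mul_of_nonneg_right (le_abs_self A) hra.le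
      _ ≤ |A| * r ^ a * (K * w r ^ e) := mul_le_mul_of_nonneg_left h2 (by positivity)
      _ = |A| * K * (r ^ a * w r ^ e) := by ring
      _ ≤ _ := mul_le_mul_of_nonneg_right (le_max_left _ _) (by positivity)
  · have h1 := hL r ⟨hrd, hr.2⟩
    have h2 : 1 ≤ L * r ^ a := by
      have := mul_le_mul_of_nonneg_right h1 hra.le
      rwa [← rpow_add hr.1, neg_add_cancel, rpow_zero] at this
    calc |f r| ≤ B * w r ^ e := hR r ⟨hrd, hr.2⟩
      _ ≤ |B| * w r ^ e * 1 := by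
        rw [mul_one]
        exact mul_le_mul_of_nonneg_right (le_abs_self B) hwe.le
      _ ≤ |B| * w r ^ e * (L * r ^ a) := mul_le_mul_of_nonneg_left h2 (by positivity)
      _ = |B| * L * (r ^ a * w r ^ e) := by ring
      _ ≤ _ := mul_le_mul_of_nonneg_right (le_max_right _ _) (by positivity)

theorem bound_near (h : IsEnthalpyProfile α c R w) {d : ℝ} (hd : d ∈ Ioo 0 R)
    {f : ℝ → ℝ} {a e C : ℝ} (hf : ∀ r ∈ Ioo 0 R, |f r| ≤ C * (r ^ a * w r ^ e)) :
    (∃ A, 0 < A ∧ ∀ r ∈ Ioc 0 d, |f r| ≤ A * r ^ a) ∧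
      ∃ B, 0 < B ∧ ∀ r ∈ Ico d R, |f r| ≤ B * w r ^ e := by
  obtain ⟨K, hK0, hK⟩ := h.exists_rpow_le hd e
  obtain ⟨L, hL0, hL⟩ := exists_rpow_le_of_mem_Ico hd.1 hd.2 a
  have hC : C ≤ |C| + 1 := by linarith [le_abs_self C]
  have hC0 : 0 < |C| + 1 := by positivity
  refine ⟨⟨(|C| + 1) * K, by positivity, fun r hr => ?_⟩,
    (|C| + 1) * L, by positivity, fun r hr => ?_⟩
  · have hrI : r ∈ Ioo 0 R := ⟨hr.1, hr.2.trans_lt hd.2⟩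
    have hra := rpow_pos_of_pos hr.1 a
    have hwe := rpow_pos_of_pos (h.pos hrI) e
    calc |f r| ≤ C * (r ^ a * w r ^ e) := hf r hrI
      _ ≤ (|C| + 1) * (r ^ a * w r ^ e) := mul_le_mul_of_nonneg_right hC (by positivity)
      _ ≤ (|C| + 1) * (r ^ a * K) := by gcongr; exact hK r hr
      _ = _ := by ring
  · have hrI : r ∈ Ioo 0 R := ⟨hd.1.trans_le hr.1, hr.2⟩
    have hra := rpow_pos_of_pos hrI.1 a
    have hwe := rpow_pos_of_pos (h.pos hrI) e
    calc |f r| ≤ C * (r ^ a * w r ^ e) := hf r hrI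
      _ ≤ (|C| + 1) * (r ^ a * w r ^ e) := mul_le_mul_of_nonneg_right hC (by positivity)
      _ ≤ (|C| + 1) * (L * w r ^ e) := by gcongr; exact hL r hr
      _ = _ := by ring

/-- Integrating a weighted bound from the endpoints, where the function vanishes. -/
theorem exists_bound_of_tendsto_zero (h : IsEnthalpyProfile α c R w) {Y Y' : ℝ → ℝ} {a e C : ℝ}
    (ha : -1 < a) (he : -1 < e) (hY : ∀ r ∈ Ioo 0 R, HasDerivAt Y (Y' r) r)
    (hb : ∀ r ∈ Ioo 0 R, |Y' r| ≤ C * (r ^ a * w r ^ e))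
    (h0 : Tendsto Y (nhdsWithin 0 (Ioi 0)) (nhds 0))
    (hR : Tendsto Y (nhdsWithin R (Iio R)) (nhds 0)) :
    ∃ D, ∀ r ∈ Ioo 0 R, |Y r| ≤ D * (r ^ (a + 1) * w r ^ (e + 1)) := by
  obtain ⟨d, hd, m, hm, M, hslope⟩ := h.exists_slope
  obtain ⟨⟨A, hA0, hA⟩, B, hB0, hB⟩ := h.bound_near hd hb
  have ha' : 0 < a + 1 := by linarith
  have he' : 0 < e + 1 := by linarith
  refine h.exists_bound_of_near hd (A := A / (a + 1)) (B := B / (m * (e + 1)))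
    (fun r hr => ?_) fun r hr => ?_
  · have hsub : ∀ x ∈ Ioc 0 d, x ∈ Ioo 0 R := fun x hx => ⟨hx.1, hx.2.trans_lt hd.2⟩
    have key : ∀ x ∈ Ioc 0 r, |Y r - Y x| ≤ A / (a + 1) * r ^ (a + 1) - A / (a + 1) * x ^ (a + 1) :=
      fun x hx => abs_sub_le_sub_of_abs_deriv_le (convex_Ioc 0 d)
        (Z := fun x => A / (a + 1) * x ^ (a + 1)) (fun x hx => hY x (hsub x hx))
        (fun x hx => ((hasDerivAt_rpow_const (p := a + 1) (Or.inl hx.1.ne')).const_mul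
          (A / (a + 1))).congr_deriv (g' := A * x ^ a) (by
            rw [add_sub_cancel_right]
            field_simp))
        hA ⟨hx.1, hx.2.trans hr.2⟩ hr hx.2
    have lim1 : Tendsto (fun x => |Y r - Y x|) (nhdsWithin 0 (Ioi 0)) (nhds |Y r - 0|) :=
      (tendsto_const_nhds.sub h0).abs
    have lim2 : Tendsto (fun x : ℝ => A / (a + 1) * r ^ (a + 1) - A / (a + 1) * x ^ (a + 1))
        (nhdsWithin 0 (Ioi 0)) (nhds (A / (a + 1) * r ^ (a + 1) - A / (a + 1) * 0)) := by
      refine tendsto_const_nhds.sub (tendsto_const_nhds.mul ?_)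
      have := (continuousAt_rpow_const (0 : ℝ) (a + 1) (Or.inr ha'.le)).tendsto
      rw [zero_rpow ha'.ne'] at this
      exact this.mono_left nhdsWithin_le_nhds
    have := le_of_tendsto_of_tendsto lim1 lim2 (by
      filter_upwards [Ioo_mem_nhdsGT hr.1] with x hx using key x ⟨hx.1, hx.2.le⟩)
    simpa using this
  · have hsub : ∀ x ∈ Ico d R, x ∈ Ioo 0 R := fun x hx => ⟨hd.1.trans_le hx.1, hx.2⟩
    set Q := B / (m * (e + 1)) with hQ
    have hQ0 : 0 < Q := by positivity
    have key : ∀ x ∈ Ico r R, |Y x - Y r| ≤ -Q * w x ^ (e + 1) - -Q * w r ^ (e + 1) :=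
      fun x hx => abs_sub_le_sub_of_abs_deriv_le (convex_Ico d R)
        (Z := fun x => -Q * w x ^ (e + 1)) (fun x hx => hY x (hsub x hx))
        (fun x hx => (h.hasDerivAt_rpow (e + 1) (hsub x hx)).const_mul (-Q))
        (fun x hx => by
          refine (hB x hx).trans ?_
          rw [add_sub_cancel_right]
          have hp := rpow_pos_of_pos (h.pos (hsub x hx)) e
          have hs := (hslope x hx).1
          have : Q * (e + 1) * m = B := by rw [hQ]; field_simp
          rw [← this]
          have h5 : 0 ≤ Q * (e + 1) * w x ^ e := by positivity
          nlinarith)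
        hr ⟨hr.1.trans hx.1, hx.2⟩ hx.1
    have lim1 : Tendsto (fun x => |Y x - Y r|) (nhdsWithin R (Iio R)) (nhds |0 - Y r|) :=
      (hR.sub tendsto_const_nhds).abs
    have lim2 : Tendsto (fun x : ℝ => -Q * w x ^ (e + 1) - -Q * w r ^ (e + 1))
        (nhdsWithin R (Iio R)) (nhds (-Q * 0 - -Q * w r ^ (e + 1))) := by
      refine (tendsto_const_nhds.mul ?_).sub tendsto_const_nhds
      have := (continuousAt_rpow_const (0 : ℝ) (e + 1) (Or.inr he'.le)).tendsto
      rw [zero_rpow he'.ne'] at this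
      exact this.comp h.tendsto_zero
    have := le_of_tendsto_of_tendsto lim1 lim2 (by
      filter_upwards [Ioo_mem_nhdsLT hr.2] with x hx using key x ⟨hx.1.le, hx.2⟩)
    simpa using this

/-- Integrating a weighted bound from the interior, with loss of one power at both endpoints. -/
theorem exists_bound_of_deriv_bound (h : IsEnthalpyProfile α c R w) {f f' : ℝ → ℝ} {p q C : ℝ}
    (hp : 1 < p) (hq : 1 < q) (hf : ∀ r ∈ Ioo 0 R, HasDerivAt f (f' r) r)
    (hb : ∀ r ∈ Ioo 0 R, |f' r| ≤ C * (r ^ (-p) * w r ^ (-q))) :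
    ∃ D, ∀ r ∈ Ioo 0 R, |f r| ≤ D * (r ^ (1 - p) * w r ^ (1 - q)) := by
  obtain ⟨d, hd, m, hm, M, hslope⟩ := h.exists_slope
  obtain ⟨⟨A, hA0, hA⟩, B, hB0, hB⟩ := h.bound_near hd hb
  have hp' : 0 < p - 1 := by linarith
  have hq' : 0 < q - 1 := by linarith
  refine h.exists_bound_of_near hd (A := |f d| * d ^ (p - 1) + A / (p - 1))
    (B := |f d| + B / (m * (q - 1))) (fun r hr => ?_) fun r hr => ?_
  · have hsub : ∀ x ∈ Ioc 0 d, x ∈ Ioo 0 R := fun x hx => ⟨hx.1, hx.2.trans_lt hd.2⟩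
    have key := abs_sub_le_sub_of_abs_deriv_le (convex_Ioc 0 d)
        (Z := fun x => -(A / (p - 1)) * x ^ (1 - p)) (fun x hx => hf x (hsub x hx))
        (fun x hx => ((hasDerivAt_rpow_const (p := 1 - p) (Or.inl hx.1.ne')).const_mul
          (-(A / (p - 1)))).congr_deriv (g' := A * x ^ (-p)) (by
            rw [show 1 - p - 1 = -p by ring]
            field_simp
            ring))
        hA hr ⟨hd.1, le_rfl⟩ hr.2
    have h1 : |f r| ≤ |f d| + |f d - f r| := by
      have := abs_sub_abs_le_abs_sub (f r) (f d)
      rw [abs_sub_comm] at this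
      linarith
    have h2 : 1 ≤ d ^ (p - 1) * r ^ (1 - p) := by
      have := rpow_le_rpow hr.1.le hr.2 hp'.le
      have h3 := mul_le_mul_of_nonneg_right this (rpow_nonneg hr.1.le (1 - p))
      rwa [← rpow_add hr.1, show p - 1 + (1 - p) = 0 by ring, rpow_zero] at h3
    have h3 : 0 ≤ A / (p - 1) * d ^ (1 - p) :=
      mul_nonneg (by positivity) (rpow_nonneg hd.1.le _)
    have h4 := mul_le_mul_of_nonneg_left h2 (abs_nonneg (f d))
    linarith
  · have hsub : ∀ x ∈ Ico d R, x ∈ Ioo 0 R := fun x hx => ⟨hd.1.trans_le hx.1, hx.2⟩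
    set Q := B / (m * (q - 1)) with hQ
    have hQ0 : 0 < Q := by positivity
    have key := abs_sub_le_sub_of_abs_deriv_le (convex_Ico d R)
        (Z := fun x => Q * w x ^ (1 - q)) (fun x hx => hf x (hsub x hx))
        (fun x hx => (h.hasDerivAt_rpow (1 - q) (hsub x hx)).const_mul Q)
        (fun x hx => by
          refine (hB x hx).trans ?_
          rw [show 1 - q - 1 = -q by ring]
          have hp := rpow_pos_of_pos (h.pos (hsub x hx)) (-q)
          have hs := (hslope x hx).1
          have : Q * (q - 1) * m = B := by rw [hQ]; field_simp
          rw [← this]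
          have h5 : 0 ≤ Q * (q - 1) * w x ^ (-q) := by positivity
          nlinarith)
        ⟨le_rfl, hd.2⟩ hr hr.1
    have h1 : |f r| ≤ |f d| + |f r - f d| := by
      have := abs_sub_abs_le_abs_sub (f r) (f d)
      linarith
    have h2 : 1 ≤ w r ^ (1 - q) :=
      one_le_rpow_of_pos_of_le_one_of_nonpos (h.pos (hsub r hr)) (h.le_one (hsub r hr))
        (by linarith)
    have h3 : 0 ≤ Q * w d ^ (1 - q) := mul_nonneg hQ0.le (rpow_nonneg (h.pos hd).le _)
    have h4 := mul_le_mul_of_nonneg_left h2 (abs_nonneg (f d))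
    linarith

theorem exists_deriv_bound (h : IsEnthalpyProfile α c R w) :
    ∃ M, 0 < M ∧ ∀ r ∈ Ioo 0 R, |deriv w r| ≤ M :=
  h.exists_bound_of_derivControl (h.derivControl_deriv 0)

/-- A flux with finite weighted energy can only converge to zero along a filter on which some
function with derivative `O(1 / (r ^ 4 * w ^ (1 + α)))` blows up. -/
theorem flux_limit_eq_zero (h : IsEnthalpyProfile α c R w) {l : Filter ℝ} [l.NeBot]
    [TendstoIxxClass Icc l l] (hl : Ioo 0 R ∈ l) {ρ ρ' : ℝ → ℝ}
    (hρ : ∀ r ∈ Ioo 0 R, HasDerivAt ρ (ρ' r) r) (hρl : Tendsto (fun r => ‖ρ r‖) l atTop)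
    {C : ℝ} (hρ' : ∀ r ∈ Ioo 0 R, |ρ' r| ≤ C * (r ^ 4 * w r ^ (1 + α))⁻¹)
    {Y : ℝ → ℝ} {y : ℝ} (hYl : Tendsto Y l (nhds y))
    (hint : IntegrableOn (fun r => Y r ^ 2 * (r ^ 4 * w r ^ (1 + α))⁻¹) (Ioo 0 R)) : y = 0 := by
  by_contra hy
  refine not_integrableOn_of_tendsto_norm_atTop_of_deriv_isBigO_filter l hl
    (by filter_upwards [hl] with r hr using (hρ r hr).differentiableAt) hρl ?_ hint
  have hy2 : 0 < y ^ 2 := by positivity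
  have hev : ∀ᶠ r in l, y ^ 2 / 2 < Y r ^ 2 := (hYl.pow 2).eventually_const_lt (by linarith)
  refine Asymptotics.IsBigO.of_bound (|C| * (2 / y ^ 2)) ?_
  filter_upwards [hl, hev] with r hr hYr
  have hpos : 0 < (r ^ 4 * w r ^ (1 + α))⁻¹ :=
    inv_pos.2 (mul_pos (pow_pos hr.1 4) (rpow_pos_of_pos (h.pos hr) _))
  rw [(hρ r hr).deriv, Real.norm_eq_abs, Real.norm_eq_abs,
    abs_of_nonneg (mul_nonneg (sq_nonneg (Y r)) hpos.le)]
  have h1 : 1 ≤ 2 / y ^ 2 * Y r ^ 2 := by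
    rw [div_mul_eq_mul_div, le_div_iff₀ hy2]
    linarith
  calc |ρ' r| ≤ C * (r ^ 4 * w r ^ (1 + α))⁻¹ := hρ' r hr
    _ ≤ |C| * (r ^ 4 * w r ^ (1 + α))⁻¹ * 1 := by
      rw [mul_one]
      exact mul_le_mul_of_nonneg_right (le_abs_self C) hpos.le
    _ ≤ |C| * (r ^ 4 * w r ^ (1 + α))⁻¹ * (2 / y ^ 2 * Y r ^ 2) :=
      mul_le_mul_of_nonneg_left h1 (by positivity)
    _ = _ := by ring

theorem flux_limit_zero_eq_zero (h : IsEnthalpyProfile α c R w) {Y : ℝ → ℝ} {y : ℝ}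
    (hY : Tendsto Y (nhdsWithin 0 (Ioi 0)) (nhds y))
    (hint : IntegrableOn (fun r => Y r ^ 2 * (r ^ 4 * w r ^ (1 + α))⁻¹) (Ioo 0 R)) : y = 0 := by
  refine h.flux_limit_eq_zero (Ioo_mem_nhdsGT h.R_pos) (ρ := Real.log) (ρ' := fun r => r⁻¹)
    (fun r hr => Real.hasDerivAt_log hr.1.ne')
    (tendsto_abs_atBot_atTop.comp Real.tendsto_log_nhdsGT_zero) (C := R ^ 3)
    (fun r hr => ?_) hY hint
  have hw := rpow_pos_of_pos (h.pos hr) (1 + α)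
  have hw1 : w r ^ (1 + α) ≤ 1 :=
    rpow_le_one (h.pos hr).le (h.le_one hr) (by linarith [h.three_lt])
  have hr0 := hr.1
  have hr3 : r ^ 3 ≤ R ^ 3 := pow_le_pow_left₀ hr0.le hr.2.le 3
  rw [abs_of_pos (inv_pos.2 hr0), ← div_eq_mul_inv, le_div_iff₀ (by positivity)]
  have : r⁻¹ * (r ^ 4 * w r ^ (1 + α)) = r ^ 3 * w r ^ (1 + α) := by field_simp
  rw [this]
  exact (mul_le_of_le_one_right (by positivity) hw1).trans hr3

theorem flux_limit_boundary_eq_zero (h : IsEnthalpyProfile α c R w) {Y : ℝ → ℝ} {y : ℝ}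
    (hY : Tendsto Y (nhdsWithin R (Iio R)) (nhds y))
    (hint : IntegrableOn (fun r => Y r ^ 2 * (r ^ 4 * w r ^ (1 + α))⁻¹) (Ioo 0 R)) : y = 0 := by
  obtain ⟨M, hM0, hM⟩ := h.exists_deriv_bound
  have hwlim : Tendsto w (nhdsWithin R (Iio R)) (nhdsWithin 0 (Ioi 0)) := by
    refine tendsto_nhdsWithin_iff.2 ⟨h.tendsto_zero, ?_⟩
    filter_upwards [Ioo_mem_nhdsLT h.R_pos] with r hr using h.pos hr
  refine h.flux_limit_eq_zero (Ioo_mem_nhdsLT h.R_pos) (ρ := fun r => Real.log (w r))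
    (ρ' := fun r => deriv w r / w r) (fun r hr => (h.hasDerivAt hr).log (h.pos hr).ne')
    (tendsto_abs_atBot_atTop.comp (Real.tendsto_log_nhdsGT_zero.comp hwlim)) (C := M * R ^ 4)
    (fun r hr => ?_) hY hint
  have hw := h.pos hr
  have hwα := rpow_pos_of_pos hw α
  have hw1 : w r ^ α ≤ 1 := rpow_le_one hw.le (h.le_one hr) (by linarith [h.three_lt])
  have hr0 := hr.1
  have hr4 : r ^ 4 ≤ R ^ 4 := pow_le_pow_left₀ hr0.le hr.2.le 4
  rw [abs_div, abs_of_pos hw, ← div_eq_mul_inv, rpow_add hw, rpow_one,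
    le_div_iff₀ (by positivity)]
  have : |deriv w r| / w r * (r ^ 4 * (w r * w r ^ α)) = |deriv w r| * (r ^ 4 * w r ^ α) := by
    field_simp
  rw [this]
  exact mul_le_mul (hM r hr) ((mul_le_of_le_one_right (by positivity) hw1).trans hr4)
    (by positivity) hM0.le

end IsEnthalpyProfile

namespace IsEnthalpyProfile

variable {α c R : ℝ} {w : ℝ → ℝ}

theorem tendsto_zero_of_bound (h : IsEnthalpyProfile α c R w) {Y : ℝ → ℝ} {a e C : ℝ}
    (ha : 0 < a) (he : 0 < e) (hY : ∀ r ∈ Ioo 0 R, |Y r| ≤ C * (r ^ a * w r ^ e)) :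
    Tendsto Y (nhdsWithin 0 (Ioi 0)) (nhds 0) ∧ Tendsto Y (nhdsWithin R (Iio R)) (nhds 0) := by
  have key : ∀ r ∈ Ioo 0 R, ‖Y r‖ ≤ |C| * r ^ a ∧ ‖Y r‖ ≤ |C| * R ^ a * w r ^ e := by
    intro r hr
    have h1 : |Y r| ≤ |C| * (r ^ a * w r ^ e) :=
      (hY r hr).trans (mul_le_mul_of_nonneg_right (le_abs_self C)
        (mul_nonneg (rpow_nonneg hr.1.le _) (rpow_nonneg (h.pos hr).le _)))
    have h2 : w r ^ e ≤ 1 := rpow_le_one (h.pos hr).le (h.le_one hr) he.le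
    have h3 : r ^ a ≤ R ^ a := rpow_le_rpow hr.1.le hr.2.le ha.le
    have h4 := rpow_nonneg hr.1.le a
    have h5 := rpow_nonneg (h.pos hr).le e
    refine ⟨h1.trans (mul_le_mul_of_nonneg_left (mul_le_of_le_one_right h4 h2) (abs_nonneg C)),
      h1.trans ?_⟩
    rw [mul_assoc]
    exact mul_le_mul_of_nonneg_left (mul_le_mul_of_nonneg_right h3 h5) (abs_nonneg C)
  constructor
  · refine squeeze_zero_norm' (a := fun r => |C| * r ^ a) ?_ ?_
    · filter_upwards [Ioo_mem_nhdsGT h.R_pos] with r hr using (key r hr).1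
    · have := (continuousAt_rpow_const (0 : ℝ) a (Or.inr ha.le)).tendsto
      rw [zero_rpow ha.ne'] at this
      simpa using (this.mono_left nhdsWithin_le_nhds).const_mul |C|
  · refine squeeze_zero_norm' (a := fun r => |C| * R ^ a * w r ^ e) ?_ ?_
    · filter_upwards [Ioo_mem_nhdsLT h.R_pos] with r hr using (key r hr).2
    · have := (continuousAt_rpow_const (0 : ℝ) e (Or.inr he.le)).tendsto
      rw [zero_rpow he.ne'] at this
      simpa using (this.comp h.tendsto_zero).const_mul (|C| * R ^ a)

end IsEnthalpyProfile

/-- The growing-mode profiles, with the equation in the divergence form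
`(w ^ (1 + α) r ^ 4 φ')' = a w ^ α r ^ 4 φ + b (w ^ (1 + α))' r ^ 3 φ`. -/
structure IsGrowingMode (α R : ℝ) (w : ℝ → ℝ) (a b : ℝ) (φ : ℝ → ℝ) : Prop where
  smooth : ContDiffOn ℝ (⊤ : ℕ∞) φ (Ioo 0 R)
  finiteNorm : FiniteNorm α R w φ
  equation : ∀ r ∈ Ioo 0 R, deriv (fun s => w s ^ (1 + α) * s ^ 4 * deriv φ s) r =
    a * (w r ^ α * r ^ 4 * φ r) + b * (deriv (fun s => w s ^ (1 + α)) r * r ^ 3 * φ r)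

/-- The coefficient of the `(j + 1)`-st derivative that is differentiated when passing from the
`j` times differentiated growing-mode equation to the next one. -/
noncomputable def commutatorCoeff (α : ℝ) (w : ℝ → ℝ) (j : ℕ) (r : ℝ) : ℝ :=
  (1 + α + j) * (r * deriv w r) + (4 + j) * w r

/-- The lower order terms of the `j` times differentiated growing-mode equation. -/
noncomputable def modeSource (α : ℝ) (w : ℝ → ℝ) (a b : ℝ) (φ : ℝ → ℝ) : ℕ → ℝ → ℝ
  | 0 => fun r => (a * r + b * (1 + α) * deriv w r) * φ r
  | j + 1 => fun r => deriv (modeSource α w a b φ j) r -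
      deriv (commutatorCoeff α w j) r * iteratedDeriv (j + 1) φ r

/-- The flux `r ^ (4 + j) * w ^ (1 + α + j) * φ ^ (j + 1)`. -/
noncomputable def modeFlux (α : ℝ) (w φ : ℝ → ℝ) (j : ℕ) (r : ℝ) : ℝ :=
  r ^ (4 + j) * w r ^ (1 + α + j) * iteratedDeriv (j + 1) φ r

namespace IsEnthalpyProfile

variable {α c R : ℝ} {w : ℝ → ℝ}

theorem smoothOn_commutatorCoeff (h : IsEnthalpyProfile α c R w) (j : ℕ) :
    ContDiffOn ℝ (⊤ : ℕ∞) (commutatorCoeff α w j) (Ioo 0 R) :=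
  (contDiffOn_const.mul (contDiffOn_id.mul h.smoothOn_deriv)).add
    (contDiffOn_const.mul h.smoothOn)

theorem derivControl_commutatorCoeff (h : IsEnthalpyProfile α c R w) (j N : ℕ) :
    DerivControl (Ioo 0 R) N (profileWeight w 0 0 (α + 1)) (commutatorCoeff α w j) := by
  have h1 : DerivControl (Ioo 0 R) N (profileWeight w 0 0 (α + 1)) (fun r => r * deriv w r) :=
    DerivControl.mul isOpen_Ioo contDiffOn_id h.smoothOn_deriv (fun _ _ _ => zero_le_one)
      (fun i r hr => h.weight_nonneg 0 0 (α + 1) i hr)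
      (fun i j r hr => by
        rw [one_mul]
        exact h.weight_mono 0 0 (by push_cast; linarith [(Nat.cast_nonneg i : (0 : ℝ) ≤ i)]) hr)
      (derivControl_id subset_rfl N) (h.derivControl_deriv N)
  have h2 : DerivControl (Ioo 0 R) N (profileWeight w 0 0 (α + 1)) w :=
    (h.derivControl N).weight_mono (fun i r hr => h.weight_nonneg 0 0 (α + 2) i hr)
      fun i r hr => h.weight_mono 0 0 (by linarith) hr
  exact (h1.const_mul (1 + α + j)).add isOpen_Ioo
    (contDiffOn_const.mul (contDiffOn_id.mul h.smoothOn_deriv))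
    (contDiffOn_const.mul h.smoothOn) (h2.const_mul (4 + j))

theorem derivControl_deriv_commutatorCoeff (h : IsEnthalpyProfile α c R w) (j N : ℕ) :
    DerivControl (Ioo 0 R) N (profileWeight w 0 0 α) (deriv (commutatorCoeff α w j)) :=
  (DerivControl.succ_iff.1 (h.derivControl_commutatorCoeff j (N + 1))).2.weight_mono
    (fun i r hr => h.weight_nonneg 0 0 (α + 1) (i + 1) hr)
    fun i r hr => h.weight_mono 0 0 (by push_cast; linarith) hr

theorem derivControl_coeff (h : IsEnthalpyProfile α c R w) (a b : ℝ) (N : ℕ) :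
    DerivControl (Ioo 0 R) N (profileWeight w 0 0 (α + 1)) (fun r => a * r + b * deriv w r) :=
  ((h.derivControl_of_bounded subset_rfl (derivControl_id subset_rfl N) (α + 1)).const_mul
    a).add isOpen_Ioo (contDiffOn_const.mul contDiffOn_id)
    (contDiffOn_const.mul h.smoothOn_deriv) ((h.derivControl_deriv N).const_mul b)

end IsEnthalpyProfile

namespace IsGrowingMode

variable {α c R : ℝ} {w : ℝ → ℝ} {a b : ℝ} {φ : ℝ → ℝ}

theorem smoothOn_iteratedDeriv (hφ : IsGrowingMode α R w a b φ) (j : ℕ) :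
    ContDiffOn ℝ (⊤ : ℕ∞) (iteratedDeriv j φ) (Ioo 0 R) := by
  induction j with
  | zero => simpa using hφ.smooth
  | succ j ih =>
    rw [iteratedDeriv_succ]
    exact ih.deriv_of_isOpen isOpen_Ioo (by simp)

theorem hasDerivAt_iteratedDeriv (hφ : IsGrowingMode α R w a b φ) (j : ℕ) {r : ℝ}
    (hr : r ∈ Ioo 0 R) : HasDerivAt (iteratedDeriv j φ) (iteratedDeriv (j + 1) φ r) r := by
  rw [iteratedDeriv_succ]
  exact (((hφ.smoothOn_iteratedDeriv j).contDiffAt (isOpen_Ioo.mem_nhds hr)).differentiableAt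
    (by simp)).hasDerivAt

theorem smoothOn_modeSource (hφ : IsGrowingMode α R w a b φ) (h : IsEnthalpyProfile α c R w)
    (j : ℕ) : ContDiffOn ℝ (⊤ : ℕ∞) (modeSource α w a b φ j) (Ioo 0 R) := by
  induction j with
  | zero =>
    exact ((contDiffOn_const.mul contDiffOn_id).add
      (contDiffOn_const.mul h.smoothOn_deriv)).mul hφ.smooth
  | succ j ih =>
    exact (ih.deriv_of_isOpen isOpen_Ioo (by simp)).sub
      (((h.smoothOn_commutatorCoeff j).deriv_of_isOpen isOpen_Ioo (by simp)).mul
        (hφ.smoothOn_iteratedDeriv (j + 1)))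

theorem derivControl_modeSource (hφ : IsGrowingMode α R w a b φ) (h : IsEnthalpyProfile α c R w)
    {p σ : ℝ} (j N : ℕ)
    (hc : DerivControl (Ioo 0 R) (N + j) (profileWeight w p σ (1 + α)) φ) :
    DerivControl (Ioo 0 R) N (profileWeight w p σ (α - j)) (modeSource α w a b φ j) := by
  have hα := h.three_lt
  induction j generalizing N with
  | zero =>
    refine DerivControl.mul isOpen_Ioo ((contDiffOn_const.mul contDiffOn_id).add
      (contDiffOn_const.mul h.smoothOn_deriv)) hφ.smooth
      (fun i r hr => h.weight_nonneg 0 0 (α + 1) i hr)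
      (fun i r hr => h.weight_nonneg p σ (1 + α) i hr)
      (fun i k r hr => h.weight_mul_le p σ ?_ hr) (h.derivControl_coeff a (b * (1 + α)) N) hc
    have hi : (0 : ℝ) ≤ i := Nat.cast_nonneg i
    have hk : (0 : ℝ) ≤ k := Nat.cast_nonneg k
    push_cast
    rcases max_cases 0 ((i : ℝ) - (α + 1)) with ⟨e1, _⟩ | ⟨e1, _⟩ <;>
    rcases max_cases 0 ((k : ℝ) - (1 + α)) with ⟨e2, _⟩ | ⟨e2, _⟩ <;>
    rcases max_cases 0 ((i : ℝ) + k - (α - 0)) with ⟨e3, _⟩ | ⟨e3, _⟩ <;>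
    rw [e1, e2, e3] <;> linarith
  | succ j ih =>
    have h1 := (DerivControl.succ_iff.1
      (ih (N + 1) (by rwa [show N + 1 + j = N + (j + 1) by ring]))).2.weight_mono
      (W := profileWeight w p σ (α - (j + 1 : ℕ)))
      (fun i r hr => h.weight_nonneg p σ _ (i + 1) hr)
      fun i r hr => h.weight_mono p σ (by push_cast; linarith) hr
    have h2 := hc.iteratedDeriv_shift
    refine h1.sub isOpen_Ioo
      ((hφ.smoothOn_modeSource h j).deriv_of_isOpen isOpen_Ioo (by simp))
      (((h.smoothOn_commutatorCoeff j).deriv_of_isOpen isOpen_Ioo (by simp)).mul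
        (hφ.smoothOn_iteratedDeriv (j + 1))) ?_
    refine DerivControl.mul isOpen_Ioo
      ((h.smoothOn_commutatorCoeff j).deriv_of_isOpen isOpen_Ioo (by simp))
      (hφ.smoothOn_iteratedDeriv (j + 1)) (fun i r hr => h.weight_nonneg 0 0 α i hr)
      (fun i r hr => h.weight_nonneg p σ (1 + α) (i + (j + 1)) hr)
      (fun i k r hr => h.weight_mul_le p σ ?_ hr)
      (h.derivControl_deriv_commutatorCoeff j N) h2
    have hi : (0 : ℝ) ≤ i := Nat.cast_nonneg i
    have hk : (0 : ℝ) ≤ k := Nat.cast_nonneg k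
    have hj : (0 : ℝ) ≤ j := Nat.cast_nonneg j
    push_cast
    rcases max_cases 0 ((i : ℝ) - α) with ⟨e1, _⟩ | ⟨e1, _⟩ <;>
    rcases max_cases 0 ((k : ℝ) + (j + 1) - (1 + α)) with ⟨e2, _⟩ | ⟨e2, _⟩ <;>
    rcases max_cases 0 ((i : ℝ) + k - (α - (j + 1))) with ⟨e3, _⟩ | ⟨e3, _⟩ <;>
    rw [e1, e2, e3] <;> linarith

/-- The `j` times differentiated growing-mode equation. -/
theorem iteratedDeriv_equation (hφ : IsGrowingMode α R w a b φ) (h : IsEnthalpyProfile α c R w)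
    (j : ℕ) : ∀ r ∈ Ioo 0 R, r * w r * iteratedDeriv (j + 2) φ r +
      commutatorCoeff α w j r * iteratedDeriv (j + 1) φ r = modeSource α w a b φ j r := by
  induction j with
  | zero =>
    intro r hr
    have hw := h.pos hr
    have e1 := (((h.hasDerivAt_rpow (1 + α) hr).mul (hasDerivAt_pow 4 r)).mul
      (hφ.hasDerivAt_iteratedDeriv 1 hr)).deriv
    have e2 := hφ.equation r hr
    rw [(h.hasDerivAt_rpow (1 + α) hr).deriv, add_sub_cancel_left] at e2
    rw [iteratedDeriv_one] at e1
    have e3 := e1.symm.trans e2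
    simp only [Pi.mul_apply, add_sub_cancel_left, rpow_add hw, rpow_one] at e3
    have hwα := rpow_pos_of_pos hw α
    have hr3 : 0 < r ^ 3 := pow_pos hr.1 3
    have hne : w r ^ α * r ^ 3 ≠ 0 := by positivity
    refine mul_left_cancel₀ hne ?_
    simp only [modeSource, commutatorCoeff, zero_add, iteratedDeriv_one]
    push_cast at e3 ⊢
    linear_combination e3
  | succ j ih =>
    intro r hr
    have e1 := ((((hasDerivAt_id r).mul (h.hasDerivAt hr)).mul
      (hφ.hasDerivAt_iteratedDeriv (j + 2) hr)).add
      (((h.smoothOn_commutatorCoeff j).contDiffAt (isOpen_Ioo.mem_nhds hr)).differentiableAt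
        (by simp) |>.hasDerivAt.mul (hφ.hasDerivAt_iteratedDeriv (j + 1) hr))).deriv
    have e2 := Filter.EventuallyEq.deriv_eq
      ((show EqOn _ _ (Ioo 0 R) from ih).eventuallyEq_of_mem (isOpen_Ioo.mem_nhds hr))
    have e3 := e1.symm.trans e2
    have e4 : commutatorCoeff α w (j + 1) r = commutatorCoeff α w j r + (w r + r * deriv w r) := by
      simp only [commutatorCoeff]
      push_cast
      ring
    simp only [modeSource]
    rw [e4, ← e3]
    simp only [id, Pi.mul_apply]
    ring

theorem hasDerivAt_modeFlux (hφ : IsGrowingMode α R w a b φ) (h : IsEnthalpyProfile α c R w)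
    (j : ℕ) {r : ℝ} (hr : r ∈ Ioo 0 R) : HasDerivAt (modeFlux α w φ j)
      (r ^ (3 + j) * w r ^ (α + j) * modeSource α w a b φ j r) r := by
  have hw := h.pos hr
  refine (((hasDerivAt_pow (4 + j) r).mul (h.hasDerivAt_rpow (1 + α + j) hr)).mul
    (hφ.hasDerivAt_iteratedDeriv (j + 1) hr)).congr_deriv ?_
  rw [← hφ.iteratedDeriv_equation h j r hr]
  have e1 : w r ^ (1 + α + j) = w r ^ (α + j) * w r := by
    rw [show 1 + α + (j : ℝ) = α + j + 1 by ring, rpow_add hw, rpow_one]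
  have e2 : r ^ (4 + j) = r ^ (3 + j) * r := by ring
  simp only [Pi.mul_apply, commutatorCoeff]
  rw [e1, show 1 + α + (j : ℝ) - 1 = α + j by ring, show 4 + j - 1 = 3 + j by omega, e2]
  push_cast
  ring

theorem modeFlux_zero_sq (h : IsEnthalpyProfile α c R w) {r : ℝ} (hr : r ∈ Ioo 0 R) :
    modeFlux α w φ 0 r ^ 2 * (r ^ 4 * w r ^ (1 + α))⁻¹ =
      w r ^ (1 + α) * r ^ 4 * deriv φ r ^ 2 := by
  have hw := rpow_pos_of_pos (h.pos hr) (1 + α)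
  have hr0 := hr.1
  simp only [modeFlux, zero_add, iteratedDeriv_one, add_zero, Nat.cast_zero]
  field_simp

theorem integrableOn_deriv_modeFlux_zero (hφ : IsGrowingMode α R w a b φ)
    (h : IsEnthalpyProfile α c R w) : IntegrableOn
      (fun r => r ^ (3 + 0) * w r ^ (α + (0 : ℕ)) * modeSource α w a b φ 0 r) (Ioo 0 R) := by
  obtain ⟨-, i2, i3⟩ := hφ.finiteNorm
  obtain ⟨M, hM0, hM⟩ := h.exists_deriv_bound
  have hα := h.three_lt
  have c1 : ContinuousOn (fun r => w r ^ α * r ^ 4) (Ioo 0 R) :=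
    (h.smoothOn_rpow α).continuousOn.mul (continuousOn_pow 4)
  have c2 : ContinuousOn (fun r => deriv (fun s => w s ^ (1 + α)) r * r ^ 3) (Ioo 0 R) :=
    ((h.smoothOn_rpow (1 + α)).continuousOn_deriv_of_isOpen isOpen_Ioo (by simp)).mul
      (continuousOn_pow 3)
  have hwα : ∀ r ∈ Ioo 0 R, 0 < w r ^ α ∧ w r ^ α ≤ 1 := fun r hr =>
    ⟨rpow_pos_of_pos (h.pos hr) α, rpow_le_one (h.pos hr).le (h.le_one hr) (by linarith)⟩
  have b1 : IntegrableOn (fun r => w r ^ α * r ^ 4) (Ioo 0 R) := by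
    refine integrableOn_Ioo_of_continuousOn_of_abs_le (C := 1 * R ^ 4) c1 fun r hr => ?_
    have hr0 := hr.1
    have := hwα r hr
    rw [abs_of_pos (by have := this.1; positivity)]
    exact mul_le_mul this.2 (pow_le_pow_left₀ hr0.le hr.2.le 4) (by positivity) zero_le_one
  have b2 : IntegrableOn (fun r => deriv (fun s => w s ^ (1 + α)) r * r ^ 3) (Ioo 0 R) := by
    refine integrableOn_Ioo_of_continuousOn_of_abs_le (C := M * (1 + α) * 1 * R ^ 3) c2
      fun r hr => ?_
    have hr0 := hr.1
    have := hwα r hr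
    rw [(h.hasDerivAt_rpow (1 + α) hr).deriv, add_sub_cancel_left, abs_mul, abs_mul, abs_mul,
      abs_of_pos this.1, abs_of_pos (by linarith : 0 < 1 + α), abs_of_pos (pow_pos hr0 3)]
    have h1 := hM r hr
    have h2 := this.2
    have h3 := this.1
    have h4 : r ^ 3 ≤ R ^ 3 := pow_le_pow_left₀ hr0.le hr.2.le 3
    gcongr
  have j1 := (integrableOn_mul_of_integrableOn_mul_sq c1 hφ.smooth.continuousOn b1 i3).const_mul a
  have j2 := (integrableOn_mul_of_integrableOn_mul_sq c2 hφ.smooth.continuousOn b2 i2).const_mul b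
  refine IntegrableOn.congr_fun (Integrable.add j1 j2) (fun r hr => ?_) measurableSet_Ioo
  simp only [modeSource, Pi.add_apply]
  rw [(h.hasDerivAt_rpow (1 + α) hr).deriv, add_sub_cancel_left, Nat.cast_zero, add_zero]
  ring_nf

theorem modeFlux_zero_tendsto (hφ : IsGrowingMode α R w a b φ) (h : IsEnthalpyProfile α c R w) :
    (∃ C, ∀ r ∈ Ioo 0 R, |modeFlux α w φ 0 r| ≤ C) ∧
      Tendsto (modeFlux α w φ 0) (nhdsWithin 0 (Ioi 0)) (nhds 0) ∧
      Tendsto (modeFlux α w φ 0) (nhdsWithin R (Iio R)) (nhds 0) := by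
  obtain ⟨hb, ⟨y, hy⟩, z, hz⟩ := exists_tendsto_endpoints h.R_pos
    (fun r hr => hφ.hasDerivAt_modeFlux h 0 hr) (hφ.integrableOn_deriv_modeFlux_zero h)
  have hint : IntegrableOn (fun r => modeFlux α w φ 0 r ^ 2 * (r ^ 4 * w r ^ (1 + α))⁻¹)
      (Ioo 0 R) :=
    hφ.finiteNorm.1.congr_fun (fun r hr => (modeFlux_zero_sq h hr).symm) measurableSet_Ioo
  obtain rfl := h.flux_limit_zero_eq_zero hy hint
  obtain rfl := h.flux_limit_boundary_eq_zero hz hint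
  exact ⟨hb, hy, hz⟩

theorem iteratedDeriv_bound_of_modeFlux_bound (h : IsEnthalpyProfile α c R w) {j : ℕ}
    {x y C : ℝ} (hb : ∀ r ∈ Ioo 0 R, |modeFlux α w φ j r| ≤ C * (r ^ x * w r ^ y)) :
    ∀ r ∈ Ioo 0 R, |iteratedDeriv (j + 1) φ r| ≤
      C * (r ^ (x - (4 + j)) * w r ^ (y - (1 + α + j))) := by
  intro r hr
  have hw := h.pos hr
  have h1 := hb r hr
  have hwp := rpow_pos_of_pos hw (1 + α + j)
  have hrp : 0 < r ^ (4 + j) := pow_pos hr.1 _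
  rw [modeFlux, abs_mul, abs_of_pos (mul_pos hrp hwp)] at h1
  rw [rpow_sub hr.1, rpow_sub hw]
  have e : r ^ ((4 : ℝ) + j) = r ^ (4 + j) := by
    rw [← rpow_natCast]
    push_cast
    rfl
  rw [e, div_mul_div_comm, mul_div_assoc', le_div_iff₀ (by positivity)]
  linarith

/-- A bound for the lower order terms of the differentiated equation yields the same bound for
the next derivative, provided the flux vanishes at both endpoints. -/
theorem iteratedDeriv_bound_of_modeSource_bound (hφ : IsGrowingMode α R w a b φ)
    (h : IsEnthalpyProfile α c R w) {j : ℕ} {p q C : ℝ} (hp : p < 4 + j) (hq : q < 1 + α + j)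
    (hb : ∀ r ∈ Ioo 0 R, |modeSource α w a b φ j r| ≤ C * (r ^ (-p) * w r ^ (-q)))
    (h0 : Tendsto (modeFlux α w φ j) (nhdsWithin 0 (Ioi 0)) (nhds 0))
    (hR : Tendsto (modeFlux α w φ j) (nhdsWithin R (Iio R)) (nhds 0)) :
    ∃ D, ∀ r ∈ Ioo 0 R, |iteratedDeriv (j + 1) φ r| ≤ D * (r ^ (-p) * w r ^ (-q)) := by
  obtain ⟨D, hD⟩ := h.exists_bound_of_tendsto_zero (a := 3 + j - p) (e := α + j - q) (C := C)
    (by linarith) (by linarith) (fun r hr => hφ.hasDerivAt_modeFlux h j hr) (fun r hr => by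
      have hw := h.pos hr
      have hwp := rpow_pos_of_pos hw (α + j)
      have hrp : 0 < r ^ (3 + j) := pow_pos hr.1 _
      have e : r ^ ((3 : ℝ) + j) = r ^ (3 + j) := by
        rw [← rpow_natCast]
        push_cast
        rfl
      rw [abs_mul, abs_of_pos (mul_pos hrp hwp), sub_eq_add_neg (3 + (j : ℝ)) p,
        rpow_add hr.1 (3 + j) (-p), sub_eq_add_neg (α + j) q, rpow_add hw (α + j) (-q), e]
      calc _ ≤ r ^ (3 + j) * w r ^ (α + j) * (C * (r ^ (-p) * w r ^ (-q))) :=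
            mul_le_mul_of_nonneg_left (hb r hr) (by positivity)
        _ = _ := by ring) h0 hR
  refine ⟨D, fun r hr => ?_⟩
  have := iteratedDeriv_bound_of_modeFlux_bound h hD r hr
  rwa [show 3 + (j : ℝ) - p + 1 - (4 + j) = -p by ring,
    show α + (j : ℝ) - q + 1 - (1 + α + j) = -q by ring] at this

theorem deriv_bound_of_bound (hφ : IsGrowingMode α R w a b φ) (h : IsEnthalpyProfile α c R w)
    {p q C : ℝ} (hp : p < 4) (hq : q < 1 + α)
    (hb : ∀ r ∈ Ioo 0 R, |φ r| ≤ C * (r ^ (-p) * w r ^ (-q))) :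
    ∃ D, ∀ r ∈ Ioo 0 R, |deriv φ r| ≤ D * (r ^ (-p) * w r ^ (-q)) := by
  obtain ⟨K, hK0, hK⟩ := h.exists_bound_of_derivControl (h.derivControl_coeff a (b * (1 + α)) 0)
  have hf := hφ.modeFlux_zero_tendsto h
  have := hφ.iteratedDeriv_bound_of_modeSource_bound h (j := 0) (p := p) (q := q) (C := K * C)
    (by simpa using hp) (by simpa using hq) (fun r hr => by
      simp only [modeSource]
      rw [abs_mul, mul_assoc K C]
      exact mul_le_mul (hK r hr) (hb r hr) (abs_nonneg _) hK0.le) hf.2.1 hf.2.2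
  simpa [iteratedDeriv_one] using this

theorem bound_improve (hφ : IsGrowingMode α R w a b φ) (h : IsEnthalpyProfile α c R w)
    {p p' q C : ℝ} (hp : p < 4) (hpp' : p ≤ p') (hp' : 1 < p') (hq : q < 1 + α) (hq' : 1 < q)
    (hb : ∀ r ∈ Ioo 0 R, |φ r| ≤ C * (r ^ (-p) * w r ^ (-q))) :
    ∃ D, ∀ r ∈ Ioo 0 R, |φ r| ≤ D * (r ^ (-(p' - 1)) * w r ^ (-(q - 1))) := by
  obtain ⟨D, hD⟩ := hφ.deriv_bound_of_bound h hp hq hb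
  obtain ⟨E, hE⟩ := h.exists_bound_of_deriv_bound (f := φ) (f' := deriv φ) (p := p') (q := q)
    (C := |D| * R ^ (p' - p)) hp' hq'
    (fun r hr => by simpa [iteratedDeriv_one] using hφ.hasDerivAt_iteratedDeriv 0 hr)
    (fun r hr => by
      have h1 := rpow_nonneg hr.1.le (-p')
      have h2 := rpow_nonneg (h.pos hr).le (-q)
      have h3 : r ^ (-p) ≤ R ^ (p' - p) * r ^ (-p') := by
        rw [show -p = (p' - p) + -p' by ring, rpow_add hr.1]
        exact mul_le_mul_of_nonneg_right (rpow_le_rpow hr.1.le hr.2.le (by linarith)) h1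
      calc |deriv φ r| ≤ D * (r ^ (-p) * w r ^ (-q)) := hD r hr
        _ ≤ |D| * (r ^ (-p) * w r ^ (-q)) := mul_le_mul_of_nonneg_right (le_abs_self D)
          (mul_nonneg (rpow_nonneg hr.1.le _) h2)
        _ ≤ |D| * (R ^ (p' - p) * r ^ (-p') * w r ^ (-q)) := by gcongr
        _ = _ := by ring)
  refine ⟨E, fun r hr => ?_⟩
  rw [neg_sub, neg_sub]
  exact hE r hr

theorem exists_bound (hφ : IsGrowingMode α R w a b φ) (h : IsEnthalpyProfile α c R w) :
    ∃ C, ∀ r ∈ Ioo 0 R, |φ r| ≤ C * (r ^ (-(1 / 2 : ℝ)) * w r ^ (-(α - 3))) := by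
  have hα := h.three_lt
  obtain ⟨C, hC⟩ := (hφ.modeFlux_zero_tendsto h).1
  have h1 := iteratedDeriv_bound_of_modeFlux_bound h (j := 0) (φ := φ) (x := 0) (y := 0) (C := C)
    (fun r hr => by simpa using hC r hr)
  obtain ⟨C₁, h2⟩ := h.exists_bound_of_deriv_bound (f := φ) (f' := deriv φ) (p := 4) (q := 1 + α)
    (C := C) (by norm_num) (by linarith)
    (fun r hr => by simpa [iteratedDeriv_one] using hφ.hasDerivAt_iteratedDeriv 0 hr)
    (fun r hr => by simpa [iteratedDeriv_one] using h1 r hr)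
  obtain ⟨C₂, h3⟩ := hφ.bound_improve h (p := 3) (p' := 3) (q := α) (C := C₁) (by norm_num) le_rfl
    (by norm_num) (by linarith) (by linarith) (fun r hr => by
      have := h2 r hr
      rwa [show (1 : ℝ) - 4 = -3 by norm_num, show 1 - (1 + α) = -α by ring] at this)
  obtain ⟨C₃, h4⟩ := hφ.bound_improve h (p' := 3 - 1) (by norm_num) le_rfl (by norm_num)
    (by linarith) (by linarith) h3
  obtain ⟨C₄, h5⟩ := hφ.bound_improve h (p' := 3 / 2) (by norm_num) (by norm_num) (by norm_num)
    (by linarith) (by linarith) h4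
  refine ⟨C₄, fun r hr => ?_⟩
  have := h5 r hr
  rwa [show (3 : ℝ) / 2 - 1 = 1 / 2 by norm_num, show α - 1 - 1 - 1 = α - 3 by ring] at this

theorem modeFlux_succ_tendsto (hφ : IsGrowingMode α R w a b φ) (h : IsEnthalpyProfile α c R w)
    {j : ℕ} {p q C D : ℝ} (hp : p < 4 + j) (hq : q < 1 + α + j)
    (hs : ∀ r ∈ Ioo 0 R, |modeSource α w a b φ j r| ≤ C * (r ^ (-p) * w r ^ (-q)))
    (hd : ∀ r ∈ Ioo 0 R, |iteratedDeriv (j + 1) φ r| ≤ D * (r ^ (-p) * w r ^ (-q))) :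
    Tendsto (modeFlux α w φ (j + 1)) (nhdsWithin 0 (Ioi 0)) (nhds 0) ∧
      Tendsto (modeFlux α w φ (j + 1)) (nhdsWithin R (Iio R)) (nhds 0) := by
  obtain ⟨K, hK0, hK⟩ := h.exists_bound_of_derivControl (h.derivControl_commutatorCoeff j 0)
  refine h.tendsto_zero_of_bound (a := 4 + j - p) (e := 1 + α + j - q) (C := C + K * D)
    (by linarith) (by linarith) fun r hr => ?_
  have hw := h.pos hr
  have hwp := rpow_pos_of_pos hw (1 + α + j)
  have hrp : 0 < r ^ (4 + j) := pow_pos hr.1 _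
  have e : r ^ ((4 : ℝ) + j) = r ^ (4 + j) := by
    rw [← rpow_natCast]
    push_cast
    rfl
  have e1 : modeFlux α w φ (j + 1) r = r ^ (4 + j) * w r ^ (1 + α + j) *
      (modeSource α w a b φ j r - commutatorCoeff α w j r * iteratedDeriv (j + 1) φ r) := by
    rw [← hφ.iteratedDeriv_equation h j r hr, modeFlux]
    push_cast
    rw [show 1 + α + ((j : ℝ) + 1) = 1 + α + j + 1 by ring, rpow_add hw (1 + α + j) 1, rpow_one]
    ring
  rw [e1, abs_mul, abs_of_pos (mul_pos hrp hwp), sub_eq_add_neg (4 + (j : ℝ)) p,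
    rpow_add hr.1 (4 + j) (-p), sub_eq_add_neg (1 + α + (j : ℝ)) q,
    rpow_add hw (1 + α + j) (-q), e]
  have h1 : |modeSource α w a b φ j r - commutatorCoeff α w j r * iteratedDeriv (j + 1) φ r| ≤
      C * (r ^ (-p) * w r ^ (-q)) + K * (D * (r ^ (-p) * w r ^ (-q))) := by
    refine (abs_sub _ _).trans (add_le_add (hs r hr) ?_)
    rw [abs_mul]
    exact mul_le_mul (hK r hr) (hd r hr) (abs_nonneg _) hK0.le
  calc _ ≤ r ^ (4 + j) * w r ^ (1 + α + j) *
        (C * (r ^ (-p) * w r ^ (-q)) + K * (D * (r ^ (-p) * w r ^ (-q)))) :=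
        mul_le_mul_of_nonneg_left h1 (by positivity)
    _ = _ := by ring

/-- Pointwise control of all derivatives of the growing mode. -/
theorem derivControl (hφ : IsGrowingMode α R w a b φ) (h : IsEnthalpyProfile α c R w) (j : ℕ) :
    DerivControl (Ioo 0 R) j (profileWeight w (1 / 2) (α - 3) (1 + α)) φ := by
  have hα := h.three_lt
  suffices H : DerivControl (Ioo 0 R) j (profileWeight w (1 / 2) (α - 3) (1 + α)) φ ∧
      Tendsto (modeFlux α w φ j) (nhdsWithin 0 (Ioi 0)) (nhds 0) ∧
      Tendsto (modeFlux α w φ j) (nhdsWithin R (Iio R)) (nhds 0) from H.1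
  induction j with
  | zero =>
    refine ⟨DerivControl.zero_iff.2 ?_, (hφ.modeFlux_zero_tendsto h).2⟩
    have e : max 0 (((0 : ℕ) : ℝ) - (1 + α)) = 0 := max_eq_left (by push_cast; linarith)
    simp only [profileWeight, e, add_zero]
    exact hφ.exists_bound h
  | succ j ih =>
    obtain ⟨hc, h0, hR⟩ := ih
    obtain ⟨C, hC⟩ := (hφ.derivControl_modeSource h (p := 1 / 2) (σ := α - 3) j 0
      (by rwa [Nat.zero_add])).bound
    have hj : (0 : ℝ) ≤ j := Nat.cast_nonneg j
    set q := α - 3 + max 0 (j - α)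
    have hC' : ∀ r ∈ Ioo 0 R, |modeSource α w a b φ j r| ≤
        C * (r ^ (-(1 / 2 : ℝ)) * w r ^ (-q)) := by
      intro r hr
      have := hC r hr
      rwa [profileWeight, show ((0 : ℕ) : ℝ) - (α - j) = j - α by push_cast; ring] at this
    have hq' : q < 1 + α + j := by
      have : max 0 ((j : ℝ) - α) ≤ j := max_le hj (by linarith)
      linarith
    obtain ⟨D, hD⟩ := hφ.iteratedDeriv_bound_of_modeSource_bound h (p := 1 / 2) (q := q) (j := j)
      (by linarith) hq' hC' h0 hR
    refine ⟨fun i hi => ?_, hφ.modeFlux_succ_tendsto h (by linarith) hq' hC' hD⟩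
    rcases Nat.lt_or_ge i (j + 1) with hlt | hge
    · exact hc i (by omega)
    · obtain rfl : i = j + 1 := by omega
      refine ⟨D, fun r hr => ?_⟩
      have := hD r hr
      rwa [profileWeight, show ((j + 1 : ℕ) : ℝ) - (1 + α) = j - α by push_cast; ring]

end IsGrowingMode

/-- Higher regularity of the growing mode: for each integer `1 ≤ k ≤ 2α + 1`,
`∫₀^R w^{1+α+k} r⁴ |∂_r^{k+1} φ₀|² dr < ∞`. -/
theorem growingMode_higher_regularity
    (α c R : ℝ) (hα : 3 < α) (hα' : α < 5) (hc : 0 < c) (hR : 0 < R)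
    (w : ℝ → ℝ)
    (hw_cont : ContinuousOn w (Set.Icc 0 R))
    (hw_smooth : ContDiffOn ℝ (⊤ : ℕ∞) w (Set.Ico 0 R))
    (hw0 : w 0 = 1) (hw'0 : deriv w 0 = 0)
    (hw_pos : ∀ r, 0 ≤ r → r < R → 0 < w r)
    (hwR : w R = 0)
    (hw_dec : ∀ r, 0 < r → r < R → deriv w r < 0)
    (hw_pv : ∃ w'R : ℝ, w'R < 0 ∧
      Filter.Tendsto (deriv w) (nhdsWithin R (Set.Iio R)) (nhds w'R))
    (hw_ode : ∀ r, 0 < r → r < R →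
      deriv (deriv w) r + (2 / r) * deriv w r + c * w r ^ α = 0)
    (φ₀ : ℝ → ℝ) (μ₀ : ℝ) (hμ₀ : 0 < μ₀)
    (hφ_smooth : ContDiffOn ℝ (⊤ : ℕ∞) φ₀ (Set.Ioo 0 R))
    (hφ_norm : FiniteNorm α R w φ₀)
    (hφ_eq : ∀ r ∈ Set.Ioo (0:ℝ) R,
      μ₀ * w r ^ α * r ^ 4 * φ₀ r =
        ((1 + α) / α) * deriv (fun s => w s ^ (1 + α) * s ^ 4 * deriv φ₀ s) r
          - (4 - 3 * (1 + α) / α) * deriv (fun s => w s ^ (1 + α)) r * r ^ 3 * φ₀ r) :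
    ∀ k : ℕ, 1 ≤ k → (k : ℝ) ≤ 2 * α + 1 →
      MeasureTheory.IntegrableOn
        (fun r => w r ^ (1 + α + k) * r ^ 4 * (iteratedDeriv (k + 1) φ₀ r) ^ 2)
        (Set.Ioo 0 R) := by
  intro k _ hk2
  have h : IsEnthalpyProfile α c R w := ⟨hα, hR, hw_cont, hw_smooth, hw0, hw_pos, hwR,
    hw_dec, hw_pv, hw_ode⟩
  have hφ : IsGrowingMode α R w (μ₀ / ((1 + α) / α)) ((4 - 3 * (1 + α) / α) / ((1 + α) / α)) φ₀ :=
    ⟨hφ_smooth, hφ_norm, fun r hr => by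
      have hβ : (1 + α) / α ≠ 0 := (div_pos (by linarith) (by linarith)).ne'
      refine mul_left_cancel₀ hβ ?_
      rw [mul_add, ← mul_assoc, ← mul_assoc ((1 + α) / α) (_ / _), mul_div_cancel₀ _ hβ,
        mul_div_cancel₀ _ hβ]
      linarith [hφ_eq r hr]⟩
  obtain ⟨C, hC⟩ := hφ.derivControl h (k + 1) (k + 1) le_rfl
  refine integrableOn_Ioo_of_continuousOn_of_abs_le (C := C ^ 2 * R ^ (3 : ℝ))
    (((h.smoothOn_rpow _).continuousOn.mul (continuousOn_pow 4)).mul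
      ((hφ.smoothOn_iteratedDeriv (k + 1)).continuousOn.pow 2)) fun r hr => ?_
  have hw := h.pos hr
  have hr0 := hr.1
  have hwp := rpow_pos_of_pos hw (1 + α + k)
  set e := α - 3 + max 0 (((k + 1 : ℕ) : ℝ) - (1 + α)) with he
  have he' : 0 ≤ 1 + α + k - 2 * e := by
    push_cast at he
    rcases max_cases 0 ((k : ℝ) + 1 - (1 + α)) with ⟨e1, _⟩ | ⟨e1, _⟩ <;> rw [e1] at he <;>
      linarith [(Nat.cast_nonneg k : (0 : ℝ) ≤ k)]
  rw [abs_of_nonneg (by positivity)]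
  have h1 : iteratedDeriv (k + 1) φ₀ r ^ 2 ≤
      C ^ 2 * ((r ^ (-(1 / 2 : ℝ))) ^ 2 * (w r ^ (-e)) ^ 2) := by
    have := pow_le_pow_left₀ (abs_nonneg _) (hC r hr) 2
    rw [sq_abs] at this
    simpa only [profileWeight, mul_pow] using this
  have h2 : r ^ 4 * (r ^ (-(1 / 2 : ℝ))) ^ 2 = r ^ (3 : ℝ) := by
    rw [← rpow_natCast, ← rpow_natCast, ← rpow_mul hr0.le, ← rpow_add hr0]
    norm_num
  have h3 : w r ^ (1 + α + k) * (w r ^ (-e)) ^ 2 = w r ^ (1 + α + k - 2 * e) := by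
    rw [← rpow_natCast (w r ^ (-e)), ← rpow_mul hw.le, ← rpow_add hw]
    congr 1
    push_cast
    ring
  calc w r ^ (1 + α + k) * r ^ 4 * iteratedDeriv (k + 1) φ₀ r ^ 2
      ≤ w r ^ (1 + α + k) * r ^ 4 * (C ^ 2 * ((r ^ (-(1 / 2 : ℝ))) ^ 2 * (w r ^ (-e)) ^ 2)) :=
        mul_le_mul_of_nonneg_left h1 (by positivity)
    _ = C ^ 2 * ((r ^ 4 * (r ^ (-(1 / 2 : ℝ))) ^ 2) *
          (w r ^ (1 + α + k) * (w r ^ (-e)) ^ 2)) := by ring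
    _ = C ^ 2 * (r ^ (3 : ℝ) * w r ^ (1 + α + k - 2 * e)) := by rw [h2, h3]
    _ ≤ C ^ 2 * (R ^ (3 : ℝ) * 1) := by
        gcongr
        · exact hr.2.le
        · exact rpow_le_one hw.le (h.le_one hr) he'
    _ = C ^ 2 * R ^ (3 : ℝ) := by ring
end

section
/- (General Hardy inequality) Let k be a real number and let g : (0,1) → ℝ be weakly differentiable with ∫₀¹ s^k (g(s)² + g'(s)²) ds < ∞. (1) If k > 1, then there exists a constant C > 0 depending only on k such that ∫₀¹ s^{k−2} g(s)² ds ≤ C ∫₀¹ s^k (g(s)² + g'(s)²) ds. (2) If k < 1, then g has a trace at 0, i.e. the limit g(0) := lim_{s→0⁺} g(s) exists, and there exists C > 0 depending only on k such that ∫₀¹ s^{k−2} (g(s) − g(0))² ds ≤ C ∫₀¹ s^k g'(s)² ds. -/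
open MeasureTheory Real Filter Set

theorem mul_integral_le_of_hasDerivAt_le {F F' u v : ℝ → ℝ} {a b c C : ℝ} (hab : a ≤ b)
    (hF : ∀ x ∈ Icc a b, HasDerivAt F (F' x) x) (hu : IntegrableOn u (Icc a b))
    (hv : IntegrableOn v (Icc a b)) (h : ∀ x ∈ Ioo a b, F' x ≤ C * v x - c * u x) :
    c * ∫ x in a..b, u x ≤ C * (∫ x in a..b, v x) - (F b - F a) := by
  have key := intervalIntegral.sub_le_integral_of_hasDeriv_right_of_le
    (φ := fun x => C * v x - c * u x) hab
    (fun x hx => (hF x hx).continuousAt.continuousWithinAt)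
    (fun x hx => (hF x (Ioo_subset_Icc_self hx)).hasDerivWithinAt)
    ((hv.const_mul C).sub (hu.const_mul c)) h
  have hu' : IntervalIntegrable u volume a b :=
    (intervalIntegrable_iff_integrableOn_Icc_of_le hab).2 hu
  have hv' : IntervalIntegrable v volume a b :=
    (intervalIntegrable_iff_integrableOn_Icc_of_le hab).2 hv
  rw [intervalIntegral.integral_sub (hv'.const_mul C) (hu'.const_mul c),
    intervalIntegral.integral_const_mul, intervalIntegral.integral_const_mul] at key
  linarith

theorem integrableOn_Ioo_and_integral_le_of_intervalIntegral_le {f : ℝ → ℝ} {M : ℝ}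
    (hf : ContinuousOn f (Ioo 0 1)) (hf0 : ∀ x ∈ Ioo (0 : ℝ) 1, 0 ≤ f x)
    (h : ∀ a b : ℝ, 0 < a → a ≤ 1 / 2 → 1 / 2 ≤ b → b < 1 → ∫ x in a..b, f x ≤ M) :
    IntegrableOn f (Ioo 0 1) ∧ ∫ x in Ioo (0 : ℝ) 1, f x ≤ M := by
  set a : ℕ → ℝ := fun n => 1 / ((n : ℝ) + 1) / 2
  have ha0 : ∀ n, 0 < a n := fun n => by positivity
  have ha1 : ∀ n, a n ≤ 1 / 2 := fun n => by
    have : 1 / ((n : ℝ) + 1) ≤ 1 := by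
      rw [div_le_one (by positivity)]
      linarith [n.cast_nonneg (α := ℝ)]
    simp only [a]
    linarith
  have ha : Tendsto a atTop (nhds 0) := by
    simpa [a] using (tendsto_one_div_add_atTop_nhds_zero_nat (𝕜 := ℝ)).div_const 2
  have hb : Tendsto (fun n => 1 - a n) atTop (nhds 1) := by
    simpa using tendsto_const_nhds.sub ha
  have hcover := aecover_Ioo_of_Ioc (μ := volume) ha hb
  have hsub : ∀ n, Icc (a n) (1 - a n) ⊆ Ioo 0 1 := fun n x hx =>
    ⟨(ha0 n).trans_le hx.1, hx.2.trans_lt (by linarith [ha0 n])⟩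
  have hinter : ∀ n, Ioc (a n) (1 - a n) ∩ Ioo 0 1 = Ioc (a n) (1 - a n) := fun n =>
    inter_eq_left.2 (Ioc_subset_Icc_self.trans (hsub n))
  have hbound : ∀ n, ∫ x in Ioc (a n) (1 - a n), f x ∂(volume.restrict (Ioo 0 1)) ≤ M := by
    intro n
    rw [Measure.restrict_restrict measurableSet_Ioc, hinter,
      ← intervalIntegral.integral_of_le (by linarith [ha1 n])]
    exact h _ _ (ha0 n) (ha1 n) (by linarith [ha1 n]) (by linarith [ha0 n])
  have hint : IntegrableOn f (Ioo 0 1) := by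
    refine hcover.integrable_of_integral_bounded_of_nonneg_ae M (fun n => ?_)
      ((ae_restrict_iff' measurableSet_Ioo).2 (ae_of_all _ hf0)) (Eventually.of_forall hbound)
    rw [IntegrableOn, Measure.restrict_restrict measurableSet_Ioc, hinter]
    exact ((hf.mono (hsub n)).integrableOn_Icc).mono_set Ioc_subset_Icc_self
  exact ⟨hint, le_of_tendsto (hcover.integral_tendsto_of_countably_generated hint)
    (Eventually.of_forall hbound)⟩

theorem intervalIntegral_le_integral_Ioo {f : ℝ → ℝ} {a b : ℝ}
    (hf : IntegrableOn f (Ioo 0 1)) (hf0 : ∀ x ∈ Ioo (0 : ℝ) 1, 0 ≤ f x)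
    (ha : 0 < a) (hab : a ≤ b) (hb : b < 1) :
    ∫ x in a..b, f x ≤ ∫ x in Ioo (0 : ℝ) 1, f x := by
  rw [intervalIntegral.integral_of_le hab]
  exact setIntegral_mono_set hf ((ae_restrict_iff' measurableSet_Ioo).2 (ae_of_all _ hf0))
    (LE.le.eventuallyLE fun x hx => ⟨ha.trans hx.1, hx.2.trans_lt hb⟩)

theorem rpow_sub_one_eq_mul {s : ℝ} (hs : 0 < s) (k : ℝ) : s ^ (k - 1) = s ^ (k - 2) * s := by
  rw [← rpow_add_one hs.ne']
  ring_nf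

theorem rpow_eq_mul_sq {s : ℝ} (hs : 0 < s) (k : ℝ) : s ^ k = s ^ (k - 2) * s ^ 2 := by
  rw [← rpow_two, ← rpow_add hs]
  ring_nf

theorem continuousOn_rpow_mul_sq {g : ℝ → ℝ} (hg : ContinuousOn g (Ioo 0 1)) (r : ℝ) :
    ContinuousOn (fun s => s ^ r * g s ^ 2) (Ioo 0 1) :=
  (continuousOn_id.rpow_const fun _ hx => Or.inl hx.1.ne').mul (hg.pow 2)

theorem hardy_integral_le_of_one_lt {k : ℝ} (hk : 1 < k) {g g' : ℝ → ℝ}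
    (hg : ∀ s ∈ Ioo (0 : ℝ) 1, HasDerivAt g (g' s) s)
    (hH : IntegrableOn (fun s => s ^ k * (g s ^ 2 + g' s ^ 2)) (Ioo 0 1)) {a b : ℝ}
    (ha : 0 < a) (hab : a ≤ b) (hb' : 1 / 2 ≤ b) (hb : b < 1) :
    (k - 1) / 4 * ∫ s in a..b, s ^ (k - 2) * g s ^ 2 ≤
      (8 / (k - 1) + 2 * k ^ 2 / (k - 1)) *
        ∫ s in Ioo (0 : ℝ) 1, s ^ k * (g s ^ 2 + g' s ^ 2) := by
  have hsub : Icc a b ⊆ Ioo 0 1 := fun x hx => ⟨ha.trans_le hx.1, hx.2.trans_lt hb⟩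
  have hgc : ContinuousOn g (Ioo 0 1) := fun s hs => (hg s hs).continuousAt.continuousWithinAt
  have hm : 0 < k - 1 := by linarith
  have hF : ∀ s ∈ Icc a b, HasDerivAt (fun s => -(s ^ (k - 1) * (b - s) * g s ^ 2))
      (-(((k - 1) * s ^ (k - 1 - 1) * (b - s) + s ^ (k - 1) * (-1)) * g s ^ 2 +
        s ^ (k - 1) * (b - s) * (2 * g s * g' s))) s := by
    intro s hs
    have h1 := hasDerivAt_rpow_const (x := s) (p := k - 1) (Or.inl (hsub hs).1.ne')
    have h2 : HasDerivAt (fun s => b - s) (-1) s := (hasDerivAt_id s).const_sub b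
    have h3 : HasDerivAt (fun s => g s ^ 2) (2 * g s * g' s) s := by
      simpa using (hg s (hsub hs)).fun_pow 2
    exact ((h1.mul h2).mul h3).neg
  have key := mul_integral_le_of_hasDerivAt_le (c := (k - 1) / 4)
    (C := 8 / (k - 1) + 2 * k ^ 2 / (k - 1)) hab hF
    (((continuousOn_rpow_mul_sq hgc (k - 2)).mono hsub).integrableOn_Icc)
    (hH.mono_set hsub) (by
      intro s hs
      have hs0 : 0 < s := ha.trans hs.1
      have hbs : 0 < b - s := by linarith [hs.2]
      have hw : 0 < s ^ (k - 2) := rpow_pos_of_pos hs0 _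
      rw [rpow_eq_mul_sq hs0 k, rpow_sub_one_eq_mul hs0 k, show k - 1 - 1 = k - 2 by ring]
      set w := s ^ (k - 2)
      set p := g s
      set q := g' s
      set m := k - 1 with hmdef
      have hk' : k = m + 1 := by simp [hmdef]
      have e1 : -(m * (b - s) * p ^ 2) ≤ -(m / 2 * p ^ 2) + m * s * p ^ 2 := by
        nlinarith [mul_nonneg hm.le (sq_nonneg p)]
      have e2 : -(2 * s * (b - s) * p * q) ≤ m / 8 * p ^ 2 + 8 / m * (s ^ 2 * q ^ 2) := by
        have h1 : m / 8 * p ^ 2 + 8 / m * ((b - s) ^ 2 * s ^ 2 * q ^ 2) +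
            2 * s * (b - s) * p * q = 8 / m * (m / 8 * p + (b - s) * s * q) ^ 2 := by
          field_simp
          ring
        have h2 : (b - s) ^ 2 ≤ 1 := by nlinarith
        have h3 : 8 / m * ((b - s) ^ 2 * s ^ 2 * q ^ 2) ≤ 8 / m * (s ^ 2 * q ^ 2) := by
          gcongr
          exact mul_le_of_le_one_left (sq_nonneg s) h2
        have h4 : 0 ≤ 8 / m * (m / 8 * p + (b - s) * s * q) ^ 2 := by positivity
        linarith
      have e3 : k * s ≤ m / 8 + 2 * k ^ 2 / m * s ^ 2 := by
        have h1 : m / 8 + 2 * k ^ 2 / m * s ^ 2 - k * s = 2 / m * (m / 4 - k * s) ^ 2 := by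
          field_simp
          ring
        have h2 : 0 ≤ 2 / m * (m / 4 - k * s) ^ 2 := by positivity
        linarith
      have e4 := mul_le_mul_of_nonneg_right e3 (sq_nonneg p)
      have e5 : 0 ≤ 8 / m * (s ^ 2 * p ^ 2) := by positivity
      have e6 : 0 ≤ 2 * k ^ 2 / m * (s ^ 2 * q ^ 2) := by positivity
      have e7 : -(m * (b - s) * p ^ 2) + s * p ^ 2 - 2 * s * (b - s) * p * q ≤
          (8 / m + 2 * k ^ 2 / m) * (s ^ 2 * (p ^ 2 + q ^ 2)) - m / 4 * p ^ 2 := by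
        have : k * s * p ^ 2 = m * s * p ^ 2 + s * p ^ 2 := by rw [hk']; ring
        linarith
      linarith [mul_le_mul_of_nonneg_left e7 hw.le])
  have hle := intervalIntegral_le_integral_Ioo hH
    (fun s hs => mul_nonneg (rpow_nonneg hs.1.le _) (by positivity)) ha hab hb
  have hFa : 0 ≤ a ^ (k - 1) * (b - a) * g a ^ 2 :=
    mul_nonneg (mul_nonneg (rpow_nonneg ha.le _) (by linarith)) (sq_nonneg _)
  have hC : 0 ≤ 8 / (k - 1) + 2 * k ^ 2 / (k - 1) := by positivity
  have := mul_le_mul_of_nonneg_left hle hC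
  simp only [sub_self, mul_zero, zero_mul, neg_zero] at key
  linarith

theorem hardy_integral_sub_le_of_lt_one {k : ℝ} (hk : k < 1) {g g' : ℝ → ℝ}
    (hg : ∀ s ∈ Ioo (0 : ℝ) 1, HasDerivAt g (g' s) s)
    (hJ : IntegrableOn (fun s => s ^ k * g' s ^ 2) (Ioo 0 1)) {a b : ℝ}
    (ha : 0 < a) (hab : a ≤ b) (hb : b < 1) :
    (1 - k) / 2 * ∫ s in a..b, s ^ (k - 2) * (g s - g a) ^ 2 ≤
      2 / (1 - k) * ∫ s in Ioo (0 : ℝ) 1, s ^ k * g' s ^ 2 := by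
  have hsub : Icc a b ⊆ Ioo 0 1 := fun x hx => ⟨ha.trans_le hx.1, hx.2.trans_lt hb⟩
  have hgc : ContinuousOn (fun s => g s - g a) (Ioo 0 1) := fun s hs =>
    ((hg s hs).sub_const (g a)).continuousAt.continuousWithinAt
  have hm : 0 < 1 - k := by linarith
  have hF : ∀ s ∈ Icc a b, HasDerivAt (fun s => s ^ (k - 1) * (g s - g a) ^ 2)
      ((k - 1) * s ^ (k - 1 - 1) * (g s - g a) ^ 2 +
        s ^ (k - 1) * (2 * (g s - g a) * g' s)) s := by
    intro s hs
    have h1 := hasDerivAt_rpow_const (x := s) (p := k - 1) (Or.inl (hsub hs).1.ne')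
    have h3 : HasDerivAt (fun s => (g s - g a) ^ 2) (2 * (g s - g a) * g' s) s := by
      simpa using ((hg s (hsub hs)).sub_const (g a)).fun_pow 2
    exact h1.mul h3
  have key := mul_integral_le_of_hasDerivAt_le (c := (1 - k) / 2) (C := 2 / (1 - k)) hab hF
    (((continuousOn_rpow_mul_sq hgc (k - 2)).mono hsub).integrableOn_Icc)
    (hJ.mono_set hsub) (by
      intro s hs
      have hs0 : 0 < s := ha.trans hs.1
      have hw : 0 < s ^ (k - 2) := rpow_pos_of_pos hs0 _
      rw [rpow_eq_mul_sq hs0 k, rpow_sub_one_eq_mul hs0 k, show k - 1 - 1 = k - 2 by ring]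
      set w := s ^ (k - 2)
      set p := g s - g a
      set q := g' s
      obtain ⟨m, rfl⟩ : ∃ m, k = 1 - m := ⟨1 - k, by ring⟩
      rw [sub_sub_cancel] at hm ⊢
      have h1 : 2 / m * (w * s ^ 2 * q ^ 2) - m / 2 * (w * p ^ 2) -
          ((1 - m - 1) * w * p ^ 2 + w * s * (2 * p * q)) =
          w * (2 / m * (m / 2 * p - s * q) ^ 2) := by
        field_simp
        ring
      have h2 : 0 ≤ w * (2 / m * (m / 2 * p - s * q) ^ 2) := by positivity
      linarith)
  have hle := intervalIntegral_le_integral_Ioo hJ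
    (fun s hs => mul_nonneg (rpow_nonneg hs.1.le _) (sq_nonneg _)) ha hab hb
  have hFb : 0 ≤ b ^ (k - 1) * (g b - g a) ^ 2 :=
    mul_nonneg (rpow_nonneg (ha.le.trans hab) _) (sq_nonneg _)
  have := mul_le_mul_of_nonneg_left hle (by positivity : 0 ≤ 2 / (1 - k))
  simp only [sub_self, ne_eq, OfNat.ofNat_ne_zero, not_false_eq_true, zero_pow, mul_zero] at key
  linarith

theorem aestronglyMeasurable_of_hasDerivAt_Ioo {g g' : ℝ → ℝ}
    (hg : ∀ s ∈ Ioo (0 : ℝ) 1, HasDerivAt g (g' s) s) :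
    AEStronglyMeasurable g' (volume.restrict (Ioo 0 1)) :=
  (aestronglyMeasurable_deriv g _).congr
    ((ae_restrict_iff' measurableSet_Ioo).2 (ae_of_all _ fun s hs => (hg s hs).deriv))

theorem integrableOn_rpow_mul_sq_of_hasDerivAt {k : ℝ} {g g' : ℝ → ℝ}
    (hg : ∀ s ∈ Ioo (0 : ℝ) 1, HasDerivAt g (g' s) s)
    (hH : IntegrableOn (fun s => s ^ k * (g s ^ 2 + g' s ^ 2)) (Ioo 0 1)) :
    IntegrableOn (fun s => s ^ k * g' s ^ 2) (Ioo 0 1) := by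
  refine Integrable.mono' hH ?_ ((ae_restrict_iff' measurableSet_Ioo).2 (ae_of_all _ ?_))
  · exact (by fun_prop : Measurable fun s : ℝ => s ^ k).aestronglyMeasurable.mul
      ((aestronglyMeasurable_of_hasDerivAt_Ioo hg).pow 2)
  · intro s hs
    have hw := rpow_nonneg hs.1.le k
    rw [norm_of_nonneg (by positivity)]
    gcongr
    linarith [sq_nonneg (g s)]

theorem integrableOn_of_integrableOn_rpow_mul_sq {k : ℝ} (hk : k < 1) {f : ℝ → ℝ}
    (hf : AEStronglyMeasurable f (volume.restrict (Ioo 0 1)))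
    (hJ : IntegrableOn (fun s => s ^ k * f s ^ 2) (Ioo 0 1)) :
    IntegrableOn f (Ioo 0 1) := by
  have hr : IntegrableOn (fun s : ℝ => s ^ (-k)) (Ioo 0 1) :=
    (intervalIntegral.integrableOn_Ioo_rpow_iff one_pos).2 (by linarith)
  refine Integrable.mono' (hJ.add hr) hf ((ae_restrict_iff' measurableSet_Ioo).2 (ae_of_all _ ?_))
  intro s hs
  have hw := rpow_pos_of_pos hs.1 k
  have hle : |f s| ≤ s ^ k * f s ^ 2 + s ^ (-k) := by
    rw [rpow_neg hs.1.le, ← sq_abs (f s)]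
    set w := s ^ k
    set p := |f s|
    have h1 : w * p ^ 2 + w⁻¹ - p = w⁻¹ * ((w * p - 1 / 2) ^ 2 + 3 / 4) := by
      field_simp
      ring
    have h2 : 0 ≤ w⁻¹ * ((w * p - 1 / 2) ^ 2 + 3 / 4) := by positivity
    linarith
  exact hle

theorem exists_tendsto_nhdsGT_zero_of_integrableOn_deriv {g g' : ℝ → ℝ}
    (hg : ∀ s ∈ Ioo (0 : ℝ) 1, HasDerivAt g (g' s) s) (hg' : IntegrableOn g' (Ioo 0 1)) :
    ∃ g0 : ℝ, Tendsto g (nhdsWithin 0 (Ioi 0)) (nhds g0) := by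
  have hint : IntegrableOn g' (uIcc 0 (1 / 2)) := by
    rw [uIcc_of_le (by norm_num), integrableOn_Icc_iff_integrableOn_Ioc]
    exact hg'.mono_set fun x hx => ⟨hx.1, hx.2.trans_lt (by norm_num)⟩
  have hcont := intervalIntegral.continuousOn_primitive_interval_left hint 0 left_mem_uIcc
  rw [uIcc_of_le (by norm_num)] at hcont
  have hlim : Tendsto (fun x => ∫ t in x..(1 / 2), g' t) (nhdsWithin 0 (Ioi 0))
      (nhds (∫ t in (0 : ℝ)..(1 / 2), g' t)) :=
    hcont.tendsto.mono_left (nhdsWithin_le_of_mem (Icc_mem_nhdsGT (by norm_num)))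
  refine ⟨g (1 / 2) - ∫ t in (0 : ℝ)..(1 / 2), g' t, (tendsto_const_nhds.sub hlim).congr' ?_⟩
  filter_upwards [Ioo_mem_nhdsGT (show (0 : ℝ) < 1 / 2 by norm_num)] with x hx
  have hsub : Icc x (1 / 2) ⊆ Ioo 0 1 := fun y hy =>
    ⟨hx.1.trans_le hy.1, hy.2.trans_lt (by norm_num)⟩
  rw [intervalIntegral.integral_eq_sub_of_hasDerivAt_of_le hx.2.le
    (fun y hy => (hg y (hsub hy)).continuousAt.continuousWithinAt)
    (fun y hy => hg y (hsub (Ioo_subset_Icc_self hy)))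
    ((intervalIntegrable_iff_integrableOn_Icc_of_le hx.2.le).2 (hg'.mono_set hsub))]
  ring

theorem continuous_intervalIntegral_mul_sub_sq {w g : ℝ → ℝ} {a b : ℝ}
    (hw : ContinuousOn w (uIcc a b)) (hg : ContinuousOn g (uIcc a b)) :
    Continuous fun c : ℝ => ∫ s in a..b, w s * (g s - c) ^ 2 := by
  have h0 := hw.intervalIntegrable (μ := volume)
  have h1 : IntervalIntegrable (fun s => w s * g s) volume a b := (hw.mul hg).intervalIntegrable
  have h2 : IntervalIntegrable (fun s => w s * g s ^ 2) volume a b :=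
    (hw.mul (hg.pow 2)).intervalIntegrable
  have : (fun c : ℝ => ∫ s in a..b, w s * (g s - c) ^ 2) = fun c =>
      (∫ s in a..b, w s * g s ^ 2) - 2 * c * (∫ s in a..b, w s * g s) +
        c ^ 2 * ∫ s in a..b, w s := by
    funext c
    rw [← intervalIntegral.integral_const_mul, ← intervalIntegral.integral_const_mul,
      ← intervalIntegral.integral_sub h2 (h1.const_mul _),
      ← intervalIntegral.integral_add
        (f := fun s => w s * g s ^ 2 - 2 * c * (w s * g s)) (h2.sub (h1.const_mul _)) (h0.const_mul _)]
    congr 1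
    funext s
    ring
  rw [this]
  fun_prop

/-- General Hardy inequality: for `k > 1`,
`∫₀¹ s^{k−2} g² ds ≤ C ∫₀¹ s^k (g² + g'²) ds`; for `k < 1`, `g` has a trace `g(0)` at `0`
and `∫₀¹ s^{k−2} (g − g(0))² ds ≤ C ∫₀¹ s^k g'² ds`. -/
theorem general_hardy_inequality (k : ℝ) :
    (1 < k → ∃ C > (0:ℝ), ∀ g g' : ℝ → ℝ,
      (∀ s ∈ Set.Ioo (0:ℝ) 1, HasDerivAt g (g' s) s) →
      MeasureTheory.IntegrableOn (fun s => s ^ k * ((g s) ^ 2 + (g' s) ^ 2))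
        (Set.Ioo 0 1) →
      MeasureTheory.IntegrableOn (fun s => s ^ (k - 2) * (g s) ^ 2) (Set.Ioo 0 1) ∧
      (∫ s in Set.Ioo (0:ℝ) 1, s ^ (k - 2) * (g s) ^ 2) ≤
        C * ∫ s in Set.Ioo (0:ℝ) 1, s ^ k * ((g s) ^ 2 + (g' s) ^ 2)) ∧
    (k < 1 → ∃ C > (0:ℝ), ∀ g g' : ℝ → ℝ,
      (∀ s ∈ Set.Ioo (0:ℝ) 1, HasDerivAt g (g' s) s) →
      MeasureTheory.IntegrableOn (fun s => s ^ k * ((g s) ^ 2 + (g' s) ^ 2))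
        (Set.Ioo 0 1) →
      ∃ g0 : ℝ, Filter.Tendsto g (nhdsWithin 0 (Set.Ioi 0)) (nhds g0) ∧
        MeasureTheory.IntegrableOn (fun s => s ^ (k - 2) * (g s - g0) ^ 2) (Set.Ioo 0 1) ∧
        (∫ s in Set.Ioo (0:ℝ) 1, s ^ (k - 2) * (g s - g0) ^ 2) ≤
          C * ∫ s in Set.Ioo (0:ℝ) 1, s ^ k * (g' s) ^ 2) := by
  refine ⟨fun hk => ?_, fun hk => ?_⟩
  · have hm : 0 < k - 1 := by linarith
    refine ⟨(8 / (k - 1) + 2 * k ^ 2 / (k - 1)) / ((k - 1) / 4), by positivity,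
      fun g g' hg hH => ?_⟩
    refine integrableOn_Ioo_and_integral_le_of_intervalIntegral_le
      (continuousOn_rpow_mul_sq (fun s hs => (hg s hs).continuousAt.continuousWithinAt) _)
      (fun s hs => mul_nonneg (rpow_nonneg hs.1.le _) (sq_nonneg _))
      fun a b ha ha' hb' hb => ?_
    rw [div_mul_eq_mul_div, le_div_iff₀' (by positivity)]
    exact hardy_integral_le_of_one_lt hk hg hH ha (ha'.trans hb') hb' hb
  · have hm : 0 < 1 - k := by linarith
    refine ⟨2 / (1 - k) / ((1 - k) / 2), by positivity, fun g g' hg hH => ?_⟩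
    have hgc : ContinuousOn g (Ioo 0 1) := fun s hs => (hg s hs).continuousAt.continuousWithinAt
    have hJ := integrableOn_rpow_mul_sq_of_hasDerivAt hg hH
    obtain ⟨g0, hg0⟩ := exists_tendsto_nhdsGT_zero_of_integrableOn_deriv hg
      (integrableOn_of_integrableOn_rpow_mul_sq hk (aestronglyMeasurable_of_hasDerivAt_Ioo hg) hJ)
    refine ⟨g0, hg0, integrableOn_Ioo_and_integral_le_of_intervalIntegral_le
      (continuousOn_rpow_mul_sq (hgc.sub continuousOn_const) _)
      (fun s hs => mul_nonneg (rpow_nonneg hs.1.le _) (sq_nonneg _))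
      fun a b ha ha' hb' hb => ?_⟩
    have hab : a ≤ b := ha'.trans hb'
    have hsub : Icc a b ⊆ Ioo 0 1 := fun x hx => ⟨ha.trans_le hx.1, hx.2.trans_lt hb⟩
    have hcont : Continuous fun c : ℝ => ∫ s in a..b, s ^ (k - 2) * (g s - c) ^ 2 := by
      refine continuous_intervalIntegral_mul_sub_sq ?_ ?_ <;> rw [uIcc_of_le hab]
      · exact continuousOn_id.rpow_const fun x hx => Or.inl (hsub hx).1.ne'
      · exact hgc.mono hsub
    refine le_of_tendsto ((hcont.tendsto g0).comp hg0) ?_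
    filter_upwards [Ioo_mem_nhdsGT ha] with x hx
    have hxb : x ≤ b := hx.2.le.trans hab
    have hsub' : Icc x b ⊆ Ioo 0 1 := fun y hy => ⟨hx.1.trans_le hy.1, hy.2.trans_lt hb⟩
    have hmono : ∫ s in a..b, s ^ (k - 2) * (g s - g x) ^ 2 ≤
        ∫ s in x..b, s ^ (k - 2) * (g s - g x) ^ 2 := by
      refine intervalIntegral.integral_mono_interval hx.2.le hab le_rfl
        ((ae_restrict_iff' measurableSet_Ioc).2 (ae_of_all _ fun s hs =>
          mul_nonneg (rpow_nonneg (hx.1.trans hs.1).le _) (sq_nonneg _))) ?_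
      refine (intervalIntegrable_iff_integrableOn_Icc_of_le hxb).2 ?_
      exact ((continuousOn_rpow_mul_sq (hgc.sub continuousOn_const) _).mono
        hsub').integrableOn_Icc
    refine hmono.trans ?_
    rw [div_mul_eq_mul_div, le_div_iff₀' (by positivity)]
    exact hardy_integral_sub_le_of_lt_one hk hg hJ hx.1 hxb hb
end
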